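/- arXiv:1303.4091 — 3 statements merged into one kernel-verified Lean document; each statement's English description precedes it below -/
import Mathlib

section
/- Every finitely generated amenable group G has trivial reduced ℓ^p-cohomology in degree one for all p ∈ (1, 2]: for any Cayley graph Γ of G with respect to a finite symmetric generating set, D^p(Γ) equals the D^p-closure of ℓ^p(G) + ℝ·1. -/
open scoped BigOperators ENNReal NNReal
open Filter Topology

/-- `f` is `p`-summable (`f ∈ ℓ^p`), for a real exponent `0 < p < ∞`. -/
def lpMem {ι : Type*} (p : ℝ) (f : ι → ℝ) : Prop := Summable fun i => |f i| ^ p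

/-- The `ℓ^q`-norm with exponent `q ∈ [1,∞]`, valued in `ℝ≥0∞`. -/
noncomputable def lpENorm {ι : Type*} (q : ℝ≥0∞) (f : ι → ℝ) : ℝ≥0∞ :=
  if q = ⊤ then ⨆ i, (‖f i‖₊ : ℝ≥0∞)
  else (∑' i, (‖f i‖₊ : ℝ≥0∞) ^ q.toReal) ^ (1 / q.toReal)

/-- A bounded real-valued function. -/
def BoundedFun {ι : Type*} (f : ι → ℝ) : Prop := ∃ M : ℝ, ∀ i, |f i| ≤ M

/-- A graph of bounded (locally finite) valency: each vertex has a finite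
set of neighbours, the adjacency is symmetric and there are no loops. -/
structure LFGraph (X : Type*) where
  nbr : X → Finset X
  symm : ∀ x y : X, y ∈ nbr x ↔ x ∈ nbr y
  loopless : ∀ x : X, x ∉ nbr x

namespace LFGraph

variable {X : Type*}

/-- Adjacency. -/
def Adj (G : LFGraph X) (x y : X) : Prop := y ∈ G.nbr x

/-- Connectivity of the graph. -/
def Conn (G : LFGraph X) : Prop := ∀ x y : X, Relation.ReflTransGen G.Adj x y

/-- The valency is bounded by `D`. -/
def BddVal (G : LFGraph X) (D : ℕ) : Prop := ∀ x : X, (G.nbr x).card ≤ D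

/-- The set of oriented edges. -/
abbrev Edge (G : LFGraph X) : Type _ := {e : X × X // e.2 ∈ G.nbr e.1}

/-- The gradient `∇g(x,y) = g(y) - g(x)` of a function on the vertices,
as a function on oriented edges. -/
def grad (G : LFGraph X) (g : X → ℝ) (e : G.Edge) : ℝ := g e.1.2 - g e.1.1

/-- `g ∈ D^p(Γ)`: the gradient of `g` is in `ℓ^p(E)` (`p` finite). -/
def MemDp (G : LFGraph X) (p : ℝ) (g : X → ℝ) : Prop := lpMem p (G.grad g)

/-- The `ℓ^p(E)`-norm of the gradient of `g`. -/
noncomputable def gradNorm (G : LFGraph X) (p : ℝ) (g : X → ℝ) : ℝ :=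
  (∑' e : G.Edge, |G.grad g e| ^ p) ^ (1 / p)

/-- The `D^p`-distance between `g` and `h`, with basepoint `e0`:
`‖∇(g-h)‖_{ℓ^p(E)} + |g(e0) - h(e0)|`. -/
noncomputable def dpDist (G : LFGraph X) (p : ℝ) (e0 : X) (g h : X → ℝ) : ℝ :=
  G.gradNorm p (fun x => g x - h x) + |g e0 - h e0|

/-- `g` belongs to the `D^p`-closure of `ℓ^p(X) + ℝ·1`, i.e. the class of `g`
in the degree one reduced `ℓ^p`-cohomology is trivial. -/
def InClos (G : LFGraph X) (p : ℝ) (e0 : X) (g : X → ℝ) : Prop :=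
  ∀ ε : ℝ, 0 < ε → ∃ (f : X → ℝ) (c : ℝ), lpMem p f ∧
    G.MemDp p (fun x => g x - (f x + c)) ∧
    G.dpDist p e0 g (fun x => f x + c) < ε

/-- `g` belongs to the `D^p`-closure of `ℓ^p(X)` (no constants). -/
def InClosLp (G : LFGraph X) (p : ℝ) (e0 : X) (g : X → ℝ) : Prop :=
  ∀ ε : ℝ, 0 < ε → ∃ f : X → ℝ, lpMem p f ∧
    G.MemDp p (fun x => g x - f x) ∧
    G.dpDist p e0 g f < ε

open Classical in
/-- The number of (oriented) boundary edges of a finite set `A` of vertices. -/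
noncomputable def bdry (G : LFGraph X) (A : Finset X) : ℕ :=
  ∑ x ∈ A, ((G.nbr x).filter fun y => y ∉ A).card

/-- The `d`-dimensional isoperimetric profile `IS_d`. -/
def ISdim (G : LFGraph X) (d : ℝ) : Prop :=
  ∃ κ : ℝ, 0 < κ ∧ ∀ A : Finset X, A.Nonempty →
    (A.card : ℝ) ^ (1 - 1 / d) ≤ κ * (G.bdry A : ℝ)

/-- The strong isoperimetric profile `IS_ω`. -/
def ISomega (G : LFGraph X) : Prop :=
  ∃ κ : ℝ, 0 < κ ∧ ∀ A : Finset X, A.Nonempty →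
    (A.card : ℝ) ≤ κ * (G.bdry A : ℝ)

/-- `h` is harmonic: at every vertex, the average of `h` over the
neighbours equals the value of `h`. -/
def Harmonic (G : LFGraph X) (h : X → ℝ) : Prop :=
  ∀ x : X, ∑ y ∈ G.nbr x, h y = ((G.nbr x).card : ℝ) * h x

/-- The graph is Liouville: every bounded harmonic function is constant. -/
def Liouville (G : LFGraph X) : Prop :=
  ∀ h : X → ℝ, G.Harmonic h → BoundedFun h → ∀ x y : X, h x = h y

open Classical in
/-- `walk G n x y` is the probability `P^{(n)}_x(y)` that the simple random
walk started at `x` is at `y` at time `n`. -/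
noncomputable def walk (G : LFGraph X) : ℕ → X → X → ℝ
  | 0, x, y => if y = x then 1 else 0
  | n + 1, x, y => (∑ z ∈ G.nbr x, walk G n z y) / ((G.nbr x).card : ℝ)

/-- `avg G n g x = ∑_y P^{(n)}_x(y) g(y)`, the expected value of `g` after `n`
steps of the simple random walk started at `x`. -/
noncomputable def avg (G : LFGraph X) (n : ℕ) (g : X → ℝ) (x : X) : ℝ :=
  ∑' y, G.walk n x y * g y

/-- The Markov operator of the simple random walk: average over the neighbours. -/
noncomputable def pAvg (G : LFGraph X) (f : X → ℝ) (x : X) : ℝ :=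
  (∑ y ∈ G.nbr x, f y) / ((G.nbr x).card : ℝ)

/-- Reachability in exactly `n` steps. -/
def reachN (G : LFGraph X) : ℕ → X → X → Prop
  | 0, x, y => y = x
  | n + 1, x, y => ∃ z ∈ G.nbr x, reachN G n z y

/-- The graph distance (the smallest `n` such that `y` is reachable from `x`
in `n` steps). -/
noncomputable def gdist (G : LFGraph X) (x y : X) : ℕ :=
  sInf {n : ℕ | G.reachN n x y}

/-- `f` is a quasi-isometry between the connected graphs `G` and `H`. -/
def QI {X Y : Type*} (G : LFGraph X) (H : LFGraph Y) (f : X → Y) : Prop :=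
  G.Conn ∧ H.Conn ∧ ∃ Λ C : ℝ, 1 ≤ Λ ∧ 0 ≤ C ∧
    (∀ x x' : X, (H.gdist (f x) (f x') : ℝ) ≤ Λ * (G.gdist x x') + C) ∧
    (∀ x x' : X, (G.gdist x x' : ℝ) ≤ Λ * (H.gdist (f x) (f x')) + C) ∧
    ∀ y : Y, ∃ x : X, (H.gdist (f x) y : ℝ) ≤ C

/-- Reachability avoiding the finite set `F`. -/
def reachAvoid (G : LFGraph X) (F : Finset X) : X → X → Prop :=
  Relation.ReflTransGen fun a b => b ∈ G.nbr a ∧ a ∉ F ∧ b ∉ F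

/-- The graph has at most one end: for every finite set `F` of vertices,
the complement of `F` has at most one infinite connected component. -/
def AtMostOneEnd (G : LFGraph X) : Prop :=
  ∀ F : Finset X, ∀ x y : X, x ∉ F → y ∉ F →
    {z | G.reachAvoid F x z}.Infinite → {z | G.reachAvoid F y z}.Infinite →
    G.reachAvoid F x y

end LFGraph

/-- The Cayley graph of a group with respect to a finite symmetric generating
set `S` not containing the identity: the neighbours of `x` are the `s * x`, `s ∈ S`. -/
def cayley {Γ : Type*} [Group Γ] [DecidableEq Γ] (S : Finset Γ)
    (hsym : ∀ s ∈ S, s⁻¹ ∈ S) (h1 : (1 : Γ) ∉ S) : LFGraph Γ where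
  nbr x := S.image fun s => s * x
  symm := by
    intro x y
    simp only [Finset.mem_image]
    constructor
    · rintro ⟨s, hs, rfl⟩
      exact ⟨s⁻¹, hsym s hs, by group⟩
    · rintro ⟨s, hs, rfl⟩
      exact ⟨s⁻¹, hsym s hs, by group⟩
  loopless := by
    intro x hx
    rw [Finset.mem_image] at hx
    obtain ⟨s, hs, hsx⟩ := hx
    have hs1 : s = 1 := by
      have h' : s * x = 1 * x := by rw [one_mul]; exact hsx
      exact mul_right_cancel h'
    exact h1 (hs1 ▸ hs)

/-- The ball of radius `n` in the word metric given by `S`. -/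
def cball {Γ : Type*} [Group Γ] [DecidableEq Γ] (S : Finset Γ) : ℕ → Finset Γ
  | 0 => {1}
  | n + 1 => cball S n ∪ (cball S n).biUnion fun x => S.image fun s => s * x

/-- Amenability of a group, via the Følner condition. -/
def Amenable (Γ : Type*) [Group Γ] [DecidableEq Γ] : Prop :=
  ∀ (T : Finset Γ) (ε : ℝ), 0 < ε → ∃ F : Finset Γ, F.Nonempty ∧
    ∀ t ∈ T, (((F.image fun x => t * x) \ F).card : ℝ) ≤ ε * (F.card : ℝ)

/-- The function `f` lies in `ℓ^P`, with norm at most `C`. -/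
def LpBound {ι : Type*} (P : ℝ≥0∞) (f : ι → ℝ) (C : ℝ) : Prop :=
  ∃ h : lp (fun _ : ι => ℝ) P, (h : ι → ℝ) = f ∧ ‖h‖ ≤ C

namespace LpBound

variable {ι κ : Type*} {P : ℝ≥0∞} {f g : ι → ℝ} {C D : ℝ}

theorem memℓp (h : LpBound P f C) : Memℓp f P := by
  obtain ⟨u, rfl, -⟩ := h
  exact lp.memℓp u

theorem of_memℓp (h : Memℓp f P) : ∃ C, LpBound P f C :=
  ⟨_, ⟨f, h⟩, rfl, le_rfl⟩

theorem mono (h : LpBound P f C) (hCD : C ≤ D) : LpBound P f D := by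
  obtain ⟨u, hu, hu'⟩ := h
  exact ⟨u, hu, hu'.trans hCD⟩

variable [hP : Fact (1 ≤ P)]

theorem nonneg (h : LpBound P f C) : 0 ≤ C := by
  obtain ⟨u, -, hu⟩ := h
  exact (norm_nonneg u).trans hu

theorem zero : LpBound P (fun _ : ι => (0 : ℝ)) 0 :=
  ⟨0, rfl, norm_zero.le⟩

theorem add (hf : LpBound P f C) (hg : LpBound P g D) :
    LpBound P (fun i => f i + g i) (C + D) := by
  obtain ⟨u, rfl, hu⟩ := hf
  obtain ⟨v, rfl, hv⟩ := hg
  exact ⟨u + v, rfl, (norm_add_le _ _).trans (add_le_add hu hv)⟩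

theorem sub (hf : LpBound P f C) (hg : LpBound P g D) :
    LpBound P (fun i => f i - g i) (C + D) := by
  obtain ⟨u, rfl, hu⟩ := hf
  obtain ⟨v, rfl, hv⟩ := hg
  exact ⟨u - v, rfl, (norm_sub_le _ _).trans (add_le_add hu hv)⟩

theorem const_mul (hf : LpBound P f C) (a : ℝ) :
    LpBound P (fun i => a * f i) (|a| * C) := by
  obtain ⟨u, rfl, hu⟩ := hf
  refine ⟨a • u, rfl, ?_⟩
  rw [norm_smul, Real.norm_eq_abs]
  gcongr

theorem sum {A : Type*} (s : Finset A) {F : A → ι → ℝ} {C : ℝ}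
    (h : ∀ a ∈ s, LpBound P (F a) C) :
    LpBound P (fun i => ∑ a ∈ s, F a i) (s.card * C) := by
  classical
  induction s using Finset.induction_on with
  | empty => simpa using zero
  | insert a s ha ih =>
    have h2 := (h a (Finset.mem_insert_self a s)).add
      (ih fun b hb => h b (Finset.mem_insert_of_mem hb))
    simp only [Finset.sum_insert ha, Finset.card_insert_of_notMem ha]
    refine h2.mono (le_of_eq ?_)
    push_cast
    ring

theorem comp_injective (hPt : P ≠ ⊤) (hf : LpBound P f C) {φ : κ → ι}
    (hφ : Function.Injective φ) : LpBound P (fun k => f (φ k)) C := by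
  have hC := hf.nonneg
  have hp : 0 < P.toReal := ENNReal.toReal_pos (zero_lt_one.trans_le hP.out).ne' hPt
  obtain ⟨u, rfl, hu⟩ := hf
  have hs := (lp.memℓp u).summable hp
  refine ⟨⟨fun k => u (φ k), memℓp_gen (hs.comp_injective hφ)⟩, rfl, ?_⟩
  refine lp.norm_le_of_tsum_le hp hC ?_
  refine (tsum_comp_le_tsum_of_inj hs (fun i => by positivity) hφ).trans ?_
  rw [← lp.norm_rpow_eq_tsum hp]
  gcongr

theorem of_comp (hPt : P ≠ ⊤) {φ : κ → ι} (hφ : Function.Injective φ)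
    (hf : LpBound P (fun k => f (φ k)) C) (h0 : ∀ i ∉ Set.range φ, f i = 0) :
    LpBound P f C := by
  have hC := hf.nonneg
  have hp : 0 < P.toReal := ENNReal.toReal_pos (zero_lt_one.trans_le hP.out).ne' hPt
  have h0' : ∀ i ∉ Set.range φ, ‖f i‖ ^ P.toReal = 0 := fun i hi => by
    rw [h0 i hi, norm_zero, Real.zero_rpow hp.ne']
  obtain ⟨u, hu, hu'⟩ := hf
  have hs := (lp.memℓp u).summable hp
  have he : (fun i => ‖u i‖ ^ P.toReal) = (fun i => ‖f i‖ ^ P.toReal) ∘ φ := by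
    rw [hu]; rfl
  rw [he, hφ.summable_iff h0'] at hs
  refine ⟨⟨f, memℓp_gen hs⟩, rfl, lp.norm_le_of_tsum_le hp hC ?_⟩
  have h1 : ∑' i, ‖f i‖ ^ P.toReal = ‖u‖ ^ P.toReal := by
    rw [lp.norm_rpow_eq_tsum hp, he]
    refine (hφ.tsum_eq (f := fun i => ‖f i‖ ^ P.toReal) ?_).symm
    intro i hi
    by_contra hi'
    exact hi (h0' i hi')
  change ∑' i, ‖f i‖ ^ P.toReal ≤ _
  rw [h1]
  gcongr

theorem abs_le (hf : LpBound P f C) (i : ι) : |f i| ≤ C := by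
  obtain ⟨u, rfl, hu⟩ := hf
  exact (lp.norm_apply_le_norm (zero_lt_one.trans_le hP.out).ne' u i).trans hu

theorem sum_rpow_le (hPt : P ≠ ⊤) (hf : LpBound P f C) (s : Finset ι) :
    ∑ i ∈ s, |f i| ^ P.toReal ≤ C ^ P.toReal := by
  have hp : 0 < P.toReal := ENNReal.toReal_pos (zero_lt_one.trans_le hP.out).ne' hPt
  obtain ⟨u, rfl, hu⟩ := hf
  refine (lp.sum_rpow_le_norm_rpow hp u s).trans ?_
  gcongr

end LpBound

/-- The gradient of `g` on the Cayley graph, indexed by a vertex and a generator. -/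
def cayleyGrad {Γ : Type*} [Group Γ] (S : Finset Γ) (g : Γ → ℝ) (e : Γ × S) : ℝ :=
  g (e.2 * e.1) - g e.1

section Cayley

variable {Γ : Type*} [Group Γ] {S : Finset Γ} {P : ℝ≥0∞} [hP : Fact (1 ≤ P)]
  {f g : Γ → ℝ} {C : ℝ}

theorem LpBound.translate (hPt : P ≠ ⊤) (h : LpBound P f C) (t : Γ) :
    LpBound P (fun x => f (t * x)) C :=
  h.comp_injective hPt (mul_right_injective t)

theorem LpBound.cayleyGrad_slice (hPt : P ≠ ⊤) (h : LpBound P (cayleyGrad S g) C) {s : Γ}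
    (hs : s ∈ S) : LpBound P (fun x => g (s * x) - g x) C :=
  h.comp_injective hPt (φ := fun x => (x, (⟨s, hs⟩ : S))) fun _ _ h => (Prod.ext_iff.1 h).1

theorem LpBound.cayleyGrad_of_slices (hPt : P ≠ ⊤)
    (h : ∀ s ∈ S, LpBound P (fun x => g (s * x) - g x) C) :
    LpBound P (cayleyGrad S g) (S.card * C) := by
  classical
  have key : LpBound P
      (fun e : Γ × S => ∑ s : S, if e.2 = s then cayleyGrad S g e else 0)
      ((Finset.univ : Finset S).card * C) := by
    refine LpBound.sum _ fun s _ => ?_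
    refine LpBound.of_comp hPt (φ := fun x => (x, s)) (fun _ _ h => (Prod.ext_iff.1 h).1) ?_ ?_
    · simpa [cayleyGrad] using h s s.2
    · rintro ⟨x, t⟩ hx
      rw [if_neg]
      rintro rfl
      exact hx ⟨x, rfl⟩
  simpa using key

theorem LpBound.gradient (hPt : P ≠ ⊤) (h : LpBound P f C) :
    LpBound P (cayleyGrad S f) (S.card * (C + C)) :=
  LpBound.cayleyGrad_of_slices hPt fun s _ => (h.translate hPt s).sub h

variable [DecidableEq Γ]

theorem LpBound.translate_sub (hPt : P ≠ ⊤) (h : LpBound P (cayleyGrad S g) C) (n : ℕ) :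
    ∀ t ∈ cball S n, LpBound P (fun x => g (t * x) - g x) (n * C) := by
  have hC := h.nonneg
  induction n with
  | zero =>
    intro t ht
    obtain rfl : t = 1 := by simpa [cball] using ht
    simpa using LpBound.zero
  | succ n ih =>
    intro t ht
    simp only [cball, Finset.mem_union, Finset.mem_biUnion, Finset.mem_image] at ht
    obtain ht | ⟨y, hy, s, hs, rfl⟩ := ht
    · exact (ih t ht).mono (by push_cast; nlinarith)
    · have h1 := ((h.cayleyGrad_slice hPt hs).translate hPt y).add (ih y hy)
      convert! h1 using 1
      · ext x
        rw [mul_assoc]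
        ring
      · push_cast
        ring

end Cayley

section WeaklyNull

variable {ι : Type*} {P : ℝ≥0∞} [hP : Fact (1 ≤ P)] {C : ℝ} {F : ℕ → ι → ℝ}

/-- Adding a far enough member of a bounded, pointwise null sequence is almost additive for the
`p`-th power of the `ℓ^p`-norm. -/
theorem LpBound.exists_add_rpow_le (hPt : P ≠ ⊤) (hF : ∀ n, LpBound P (F n) C)
    (hF0 : ∀ i, Tendsto (fun n => F n i) atTop (𝓝 0)) {v : ι → ℝ} {D : ℝ} (hv : LpBound P v D)
    {η : ℝ} (hη : 0 < η) :
    ∃ n D', LpBound P (fun i => v i + F n i) D' ∧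
      D' ^ P.toReal ≤ D ^ P.toReal + C ^ P.toReal + η := by
  classical
  have hp : 0 < P.toReal := ENNReal.toReal_pos (zero_lt_one.trans_le hP.out).ne' hPt
  have hP0 : 0 < P := zero_lt_one.trans_le hP.out
  have hD := hv.nonneg
  have hC := (hF 0).nonneg
  set A := D ^ P.toReal + C ^ P.toReal with hA
  have hA0 : 0 ≤ A := by positivity
  obtain ⟨δ, hδ, hδη⟩ : ∃ δ > 0, (A ^ P.toReal⁻¹ + (δ + δ)) ^ P.toReal < A + η := by
    have hc : ContinuousAt (fun t : ℝ => (A ^ P.toReal⁻¹ + (t + t)) ^ P.toReal) 0 :=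
      ContinuousAt.rpow_const (by fun_prop) (Or.inr hp.le)
    have h0 : (fun t : ℝ => (A ^ P.toReal⁻¹ + (t + t)) ^ P.toReal) 0 < A + η := by
      simp only [add_zero]
      rw [Real.rpow_inv_rpow hA0 hp.ne']
      linarith
    have hev := hc.eventually_lt_const h0
    obtain ⟨r, hr, hball⟩ := Metric.eventually_nhds_iff.1 hev
    exact ⟨r / 2, by positivity, hball (by
      rw [Real.dist_eq, sub_zero, abs_of_pos (by positivity)]; linarith)⟩
  have hv' := hv
  obtain ⟨u, rfl, hu⟩ := hv'
  obtain ⟨K, hK⟩ : ∃ K : Finset ι, ‖u - ∑ i ∈ K, lp.single P i (u i)‖ < δ := by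
    have h := (lp.hasSum_single hPt u)
    obtain ⟨K, hK⟩ := (Metric.tendsto_atTop.1 h δ hδ)
    refine ⟨K, ?_⟩
    have := hK K le_rfl
    rwa [dist_comm, dist_eq_norm] at this
  obtain ⟨n, hn⟩ : ∃ n, ∑ i ∈ K, |F n i| < δ := by
    have h : Tendsto (fun n => ∑ i ∈ K, |F n i|) atTop (𝓝 (∑ i ∈ K, |(0 : ℝ)|)) :=
      tendsto_finsetSum _ fun i _ => (hF0 i).abs
    simp only [abs_zero, Finset.sum_const_zero] at h
    exact (h.eventually_lt_const hδ).exists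
  refine ⟨n, A ^ P.toReal⁻¹ + (δ + δ), ?_, hδη.le⟩
  obtain ⟨f, hf, hfC⟩ := hF n
  set fK : lp (fun _ : ι => ℝ) P := ∑ i ∈ K, lp.single P i (f i) with hfK
  set uK : lp (fun _ : ι => ℝ) P := ∑ i ∈ K, lp.single P i (u i) with huK
  have coeK : ∀ (a : ι → ℝ) (j : ι),
      (∑ i ∈ K, lp.single P i (a i) : lp (fun _ : ι => ℝ) P) j = if j ∈ K then a j else 0 := by
    intro a j
    rw [lp.coeFn_sum, Finset.sum_apply]
    simp only [lp.coeFn_single, Pi.single_apply]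
    exact Finset.sum_ite_eq K j a
  have hfKc : ∀ j, fK j = if j ∈ K then f j else 0 := coeK f
  have huKc : ∀ j, uK j = if j ∈ K then u j else 0 := coeK u
  have hfK' : ‖fK‖ ≤ δ := by
    refine (norm_sum_le _ _).trans ?_
    simp only [lp.norm_single hP0, Real.norm_eq_abs, hf]
    exact hn.le
  have hw : ‖uK + (f - fK)‖ ≤ A ^ P.toReal⁻¹ := by
    refine lp.norm_le_of_forall_sum_le hp (by positivity) fun s => ?_
    rw [Real.rpow_inv_rpow hA0 hp.ne', ← Finset.sum_filter_add_sum_filter_not s (· ∈ K)]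
    refine add_le_add ((Finset.sum_congr rfl ?_).trans_le (hv.sum_rpow_le hPt (s.filter (· ∈ K))))
      ((Finset.sum_congr rfl ?_).trans_le ((hF n).sum_rpow_le hPt (s.filter (· ∉ K))))
    · intro i hi
      have hi := (Finset.mem_filter.1 hi).2
      simp [huKc, hfKc, hi]
    · intro i hi
      have hi := (Finset.mem_filter.1 hi).2
      simp [huKc, hfKc, hi, ← hf]
  refine ⟨(uK + (f - fK)) + ((u - uK) + fK), ?_, ?_⟩
  · rw [← hf]
    ext i
    simp only [lp.coeFn_add, lp.coeFn_sub, Pi.add_apply, Pi.sub_apply]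
    ring
  · exact (norm_add_le _ _).trans (add_le_add hw ((norm_add_le _ _).trans (add_le_add hK.le hfK')))

theorem LpBound.exists_list_sum (hPt : P ≠ ⊤) (hF : ∀ n, LpBound P (F n) C)
    (hF0 : ∀ i, Tendsto (fun n => F n i) atTop (𝓝 0)) (N : ℕ) :
    ∃ (l : List ℕ) (D : ℝ), l.length = N ∧
      LpBound P (fun i => (l.map fun n => F n i).sum) D ∧
      D ^ P.toReal ≤ N * (C ^ P.toReal + 1) := by
  have hp : 0 < P.toReal := ENNReal.toReal_pos (zero_lt_one.trans_le hP.out).ne' hPt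
  induction N with
  | zero => exact ⟨[], 0, rfl, by simpa using LpBound.zero, by simp [Real.zero_rpow hp.ne']⟩
  | succ N ih =>
    obtain ⟨l, D, hl, hb, hD⟩ := ih
    obtain ⟨n, D', hb', hD'⟩ := hb.exists_add_rpow_le hPt hF hF0 one_pos
    refine ⟨n :: l, D', by simp [hl], ?_, ?_⟩
    · simpa [add_comm] using hb'
    · push_cast
      linarith

/-- A bounded, pointwise null sequence in `ℓ^p`, `1 < p < ∞`, has averages of arbitrarily small
norm. -/
theorem LpBound.exists_average_le (hPt : P ≠ ⊤) (hP1 : 1 < P.toReal)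
    (hF : ∀ n, LpBound P (F n) C) (hF0 : ∀ i, Tendsto (fun n => F n i) atTop (𝓝 0))
    {ε : ℝ} (hε : 0 < ε) :
    ∃ l : List ℕ, l ≠ [] ∧
      LpBound P (fun i => (l.length : ℝ)⁻¹ * (l.map fun n => F n i).sum) ε := by
  have hp : 0 < P.toReal := one_pos.trans hP1
  have hC := (hF 0).nonneg
  obtain ⟨N, hN0, hN⟩ : ∃ N : ℕ, 0 < N ∧
      (C ^ P.toReal + 1) * (N : ℝ) ^ (-(P.toReal - 1)) < ε ^ P.toReal := by
    have h : Tendsto (fun N : ℕ => (C ^ P.toReal + 1) * (N : ℝ) ^ (-(P.toReal - 1))) atTop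
        (𝓝 ((C ^ P.toReal + 1) * 0)) :=
      ((tendsto_rpow_neg_atTop (by linarith)).comp tendsto_natCast_atTop_atTop).const_mul _
    rw [mul_zero] at h
    exact ((eventually_gt_atTop 0).and (h.eventually_lt_const (by positivity))).exists
  obtain ⟨l, D, hl, hb, hD⟩ := LpBound.exists_list_sum hPt hF hF0 N
  have hD0 := hb.nonneg
  have hN0' : (0 : ℝ) < N := by exact_mod_cast hN0
  refine ⟨l, by rintro rfl; simp at hl; omega, ?_⟩
  rw [hl]
  refine (hb.const_mul _).mono ?_
  rw [abs_of_pos (by positivity), ← Real.rpow_le_rpow_iff (by positivity) hε.le hp,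
    Real.mul_rpow (by positivity) hD0]
  refine le_trans ?_ hN.le
  calc (N : ℝ)⁻¹ ^ P.toReal * D ^ P.toReal
      ≤ (N : ℝ)⁻¹ ^ P.toReal * (N * (C ^ P.toReal + 1)) := by gcongr
    _ = (C ^ P.toReal + 1) * ((N : ℝ) ^ (1 : ℝ) * (N : ℝ) ^ (-P.toReal)) := by
      rw [Real.inv_rpow hN0'.le, ← Real.rpow_neg hN0'.le, Real.rpow_one]
      ring
    _ = (C ^ P.toReal + 1) * (N : ℝ) ^ (-(P.toReal - 1)) := by
      rw [← Real.rpow_add hN0']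
      ring_nf

end WeaklyNull

/-- `g` can be approximated by `ℓ^P` functions, as measured by the `ℓ^P`-norm of the gradient. -/
def GradApprox {Γ : Type*} [Group Γ] (S : Finset Γ) (P : ℝ≥0∞) (g : Γ → ℝ) : Prop :=
  ∀ ε : ℝ, 0 < ε → ∃ f : Γ → ℝ, Memℓp f P ∧ LpBound P (cayleyGrad S fun x => g x - f x) ε

theorem abs_clamp_sub_clamp_le {M : ℝ} (hM : 0 ≤ M) (a b : ℝ) :
    |max (-M) (min M a) - max (-M) (min M b)| ≤ |a - b| := by
  rw [abs_le]
  rcases le_total M a with h1 | h1 <;> rcases le_total M b with h2 | h2 <;>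
    simp only [min_eq_left, min_eq_right, h1, h2] <;>
    rcases le_total (-M) a with h3 | h3 <;> rcases le_total (-M) b with h4 | h4 <;>
    simp only [max_eq_left, max_eq_right, h3, h4, neg_le_self hM] <;>
    constructor <;> cases abs_cases (a - b) <;> linarith

theorem abs_clamp_le {M : ℝ} (hM : 0 ≤ M) (a : ℝ) : |max (-M) (min M a)| ≤ M :=
  abs_le.2 ⟨le_max_left _ _, max_le (by linarith) (min_le_left _ _)⟩

theorem clamp_eq_self {M a : ℝ} (h : |a| ≤ M) : max (-M) (min M a) = a := by
  rw [min_eq_right (abs_le.1 h).2, max_eq_right (abs_le.1 h).1]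

theorem abs_sub_clamp_sub_le {M : ℝ} (hM : 0 ≤ M) (a b : ℝ) :
    |(a - max (-M) (min M a)) - (b - max (-M) (min M b))| ≤ |a - b| := by
  rw [abs_le]
  rcases le_total M a with h1 | h1 <;> rcases le_total M b with h2 | h2 <;>
    simp only [min_eq_left, min_eq_right, h1, h2] <;>
    rcases le_total (-M) a with h3 | h3 <;> rcases le_total (-M) b with h4 | h4 <;>
    simp only [max_eq_left, max_eq_right, h3, h4, neg_le_self hM] <;>
    constructor <;> cases abs_cases (a - b) <;> linarith

theorem LpBound.eventually_of_dominated {ι A : Type*} {P : ℝ≥0∞} [hP : Fact (1 ≤ P)] (hPt : P ≠ ⊤)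
    {l : Filter A} {u : A → ι → ℝ} {v : ι → ℝ} (hv : Memℓp v P)
    (huv : ∀ᶠ a in l, ∀ i, |u a i| ≤ |v i|) (hu : ∀ i, Tendsto (fun a => u a i) l (𝓝 0))
    {ε : ℝ} (hε : 0 < ε) : ∀ᶠ a in l, LpBound P (u a) ε := by
  have hp : 0 < P.toReal := ENNReal.toReal_pos (zero_lt_one.trans_le hP.out).ne' hPt
  have hlim : Tendsto (fun a => ∑' i, ‖u a i‖ ^ P.toReal) l
      (𝓝 (∑' i : ι, (0 : ℝ))) := by
    refine tendsto_tsum_of_dominated_convergence (hv.summable hp) ?_ ?_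
    · intro i
      have h := ((hu i).norm).rpow_const (p := P.toReal) (Or.inr hp.le)
      rwa [norm_zero, Real.zero_rpow hp.ne'] at h
    · filter_upwards [huv] with a ha i
      rw [Real.norm_of_nonneg (by positivity)]
      exact Real.rpow_le_rpow (norm_nonneg _) (ha i) hp.le
  rw [tsum_zero] at hlim
  filter_upwards [huv, hlim.eventually_lt_const (show (0 : ℝ) < ε ^ P.toReal by positivity)]
    with a ha hlt
  exact ⟨⟨u a, hv.mono' ha⟩, rfl, lp.norm_le_of_tsum_le hp hε.le hlt.le⟩

section Cayley

variable {Γ : Type*} [Group Γ] {S : Finset Γ} {P : ℝ≥0∞} [hP : Fact (1 ≤ P)]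
  {f g : Γ → ℝ} {C : ℝ}

/-- It suffices to approximate bounded functions. -/
theorem GradApprox.of_bounded (hPt : P ≠ ⊤) (hg : Memℓp (cayleyGrad S g) P)
    (H : ∀ h : Γ → ℝ, Memℓp (cayleyGrad S h) P → (∃ M, ∀ x, |h x| ≤ M) → GradApprox S P h) :
    GradApprox S P g := by
  intro ε hε
  have hev : ∀ᶠ M : ℝ in atTop,
      LpBound P (cayleyGrad S fun x => g x - max (-M) (min M (g x))) (ε / 2) := by
    refine LpBound.eventually_of_dominated hPt hg ?_ ?_ (by positivity)
    · filter_upwards [eventually_ge_atTop 0] with M hM e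
      exact abs_sub_clamp_sub_le hM _ _
    · intro e
      refine tendsto_const_nhds.congr' ?_
      filter_upwards [eventually_ge_atTop (|g e.1|), eventually_ge_atTop (|g (e.2 * e.1)|)]
        with M h1 h2
      simp [cayleyGrad, clamp_eq_self h1, clamp_eq_self h2]
  obtain ⟨M, hM, hM0⟩ := (hev.and (eventually_ge_atTop 0)).exists
  obtain ⟨f, hf, hfg⟩ := H (fun x => max (-M) (min M (g x)))
    (hg.mono' fun e => abs_clamp_sub_clamp_le hM0 _ _) ⟨M, fun x => abs_clamp_le hM0 _⟩
    (ε / 2) (by positivity)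
  refine ⟨f, hf, ?_⟩
  convert! hM.add hfg using 1
  · ext e
    simp only [cayleyGrad]
    ring
  · ring

/-- A function which tends to a constant at infinity can be approximated. -/
theorem GradApprox.of_tendsto_cofinite (hPt : P ≠ ⊤) (hg : Memℓp (cayleyGrad S g) P) {c : ℝ}
    (hc : Tendsto g cofinite (𝓝 c)) : GradApprox S P g := by
  intro ε hε
  have hev : ∀ᶠ δ : ℝ in 𝓝[>] 0,
      LpBound P (cayleyGrad S fun x => max (-δ) (min δ (g x - c))) ε := by
    refine LpBound.eventually_of_dominated hPt hg ?_ ?_ hε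
    · filter_upwards [self_mem_nhdsWithin] with δ hδ e
      refine (abs_clamp_sub_clamp_le (le_of_lt hδ) _ _).trans (le_of_eq ?_)
      simp [cayleyGrad]
    · intro e
      have h : Tendsto (fun δ : ℝ => δ + δ) (𝓝[>] 0) (𝓝 0) := by
        have : Tendsto (fun δ : ℝ => δ + δ) (𝓝 0) (𝓝 (0 + 0)) := tendsto_id.add tendsto_id
        rw [add_zero] at this
        exact this.mono_left nhdsWithin_le_nhds
      refine squeeze_zero_norm' ?_ h
      filter_upwards [self_mem_nhdsWithin] with δ hδ
      exact (abs_sub _ _).trans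
        (add_le_add (abs_clamp_le (le_of_lt hδ) _) (abs_clamp_le (le_of_lt hδ) _))
  obtain ⟨δ, hδ, hδ0⟩ := (hev.and self_mem_nhdsWithin).exists
  refine ⟨fun x => (g x - c) - max (-δ) (min δ (g x - c)), ?_, ?_⟩
  · have hfin : Memℓp (fun x => (g x - c) - max (-δ) (min δ (g x - c))) (0 : ℝ≥0∞) := by
      refine memℓp_zero (((Metric.tendsto_nhds.1 hc δ hδ0)).subset ?_)
      intro x hx hlt
      refine hx ?_
      rw [clamp_eq_self (by rw [← Real.dist_eq]; exact le_of_lt hlt), sub_self]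
    exact hfin.of_exponent_ge zero_le
  · convert! hδ using 1
    ext e
    simp only [cayleyGrad]
    ring

variable [DecidableEq Γ]

/-- The average of `g` over the ball of radius `m` translated by `x`. -/
noncomputable def ballAvg (S : Finset Γ) (m : ℕ) (g : Γ → ℝ) (x : Γ) : ℝ :=
  ((cball S m).card : ℝ)⁻¹ * ∑ t ∈ cball S m, g (t * x)

theorem one_mem_cball (S : Finset Γ) (m : ℕ) : (1 : Γ) ∈ cball S m := by
  induction m with
  | zero => simp [cball]
  | succ m ih => exact Finset.mem_union_left _ ih

theorem card_cball_pos (S : Finset Γ) (m : ℕ) : (0 : ℝ) < (cball S m).card := by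
  exact_mod_cast Finset.card_pos.2 ⟨1, one_mem_cball S m⟩

theorem cball_subset_succ (S : Finset Γ) (m : ℕ) : cball S m ⊆ cball S (m + 1) :=
  Finset.subset_union_left

theorem mul_mem_cball_succ {s : Γ} (hs : s ∈ S) {m : ℕ} {x : Γ} (hx : x ∈ cball S m) :
    s * x ∈ cball S (m + 1) :=
  Finset.mem_union_right _ (Finset.mem_biUnion.2 ⟨x, hx, Finset.mem_image_of_mem _ hs⟩)

theorem mem_cball_mul_succ {s : Γ} (hs : s ∈ S) {m : ℕ} :
    ∀ x ∈ cball S m, x * s ∈ cball S (m + 1) := by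
  induction m with
  | zero =>
    intro x hx
    obtain rfl : x = 1 := by simpa [cball] using hx
    simpa using mul_mem_cball_succ hs (one_mem_cball S 0)
  | succ m ih =>
    intro x hx
    obtain hx | hx := Finset.mem_union.1 hx
    · exact cball_subset_succ S _ (ih x hx)
    · obtain ⟨y, hy, hx⟩ := Finset.mem_biUnion.1 hx
      obtain ⟨t, ht, rfl⟩ := Finset.mem_image.1 hx
      rw [mul_assoc]
      exact mul_mem_cball_succ ht (ih y hy)

theorem LpBound.sub_ballAvg (hPt : P ≠ ⊤) (h : LpBound P (cayleyGrad S g) C) (m : ℕ) :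
    LpBound P (fun x => g x - ballAvg S m g x) (m * C) := by
  have hV := card_cball_pos S m
  have h1 := (LpBound.sum (cball S m) (h.translate_sub hPt m)).const_mul
    (-((cball S m).card : ℝ)⁻¹)
  convert! h1 using 1
  · ext x
    rw [Finset.sum_sub_distrib, Finset.sum_const, nsmul_eq_mul, ballAvg]
    field_simp
    ring
  · rw [abs_neg, abs_of_pos (by positivity)]
    field_simp

theorem ballAvg_mul_sub (m : ℕ) (s x : Γ) :
    ballAvg S m g (s * x) - ballAvg S m g x = ((cball S m).card : ℝ)⁻¹ *
      (∑ t ∈ (cball S m).image (· * s) \ cball S m, (g (t * x) - g x) -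
        ∑ t ∈ cball S m \ (cball S m).image (· * s), (g (t * x) - g x)) := by
  rw [Finset.sum_sdiff_sub_sum_sdiff, Finset.sum_image (mul_left_injective s).injOn,
    Finset.sum_sub_distrib, Finset.sum_sub_distrib, ballAvg, ballAvg]
  simp only [mul_assoc]
  ring

theorem card_image_mul_sdiff_cball_le {s : Γ} (hs : s ∈ S) (m : ℕ) :
    (((cball S m).image (· * s) \ cball S m).card : ℝ) ≤
      (cball S (m + 1)).card - (cball S m).card := by
  rw [← Nat.cast_sub (Finset.card_le_card (cball_subset_succ S m)),
    ← Finset.card_sdiff_of_subset (cball_subset_succ S m)]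
  refine Nat.cast_le.2 (Finset.card_le_card (Finset.sdiff_subset_sdiff ?_ le_rfl))
  intro y hy
  obtain ⟨x, hx, rfl⟩ := Finset.mem_image.1 hy
  exact mem_cball_mul_succ hs x hx

theorem card_cball_sdiff_image_mul {s : Γ} (m : ℕ) :
    (cball S m \ (cball S m).image (· * s)).card = ((cball S m).image (· * s) \ cball S m).card :=
  Finset.card_sdiff_comm (Finset.card_image_of_injective _ (mul_left_injective s)).symm

/-- Averages over balls with small boundary have uniformly bounded gradient. -/
theorem LpBound.cayleyGrad_ballAvg (hPt : P ≠ ⊤) (h : LpBound P (cayleyGrad S g) C)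
    {K : ℝ} {m : ℕ} (hm : 1 ≤ m)
    (hK : ((cball S (m + 1)).card : ℝ) ≤ (1 + K / m) * (cball S m).card) :
    LpBound P (cayleyGrad S (ballAvg S m g)) (S.card * (4 * K * C)) := by
  have hC := h.nonneg
  have hV := card_cball_pos S m
  have hm' : (1 : ℝ) ≤ m := by exact_mod_cast hm
  refine LpBound.cayleyGrad_of_slices hPt fun s hs => ?_
  simp only [ballAvg_mul_sub]
  have hb := card_image_mul_sdiff_cball_le hs m
  have h1 := LpBound.sum ((cball S m).image (· * s) \ cball S m)
    (F := fun t x => g (t * x) - g x) (C := (m + 1 : ℕ) * C) fun t ht => by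
      obtain ⟨x, hx, rfl⟩ := Finset.mem_image.1 (Finset.mem_sdiff.1 ht).1
      exact h.translate_sub hPt _ _ (mem_cball_mul_succ hs x hx)
  have h2 := LpBound.sum (cball S m \ (cball S m).image (· * s))
    (F := fun t x => g (t * x) - g x) (C := (m + 1 : ℕ) * C) fun t ht =>
      h.translate_sub hPt _ _ (cball_subset_succ S m (Finset.mem_sdiff.1 ht).1)
  refine ((h1.sub h2).const_mul _).mono ?_
  rw [card_cball_sdiff_image_mul, abs_of_pos (by positivity), inv_mul_le_iff₀ hV]
  set b : ℝ := (((cball S m).image (· * s) \ cball S m).card : ℝ)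
  set V : ℝ := ((cball S m).card : ℝ)
  have hbm : b * m ≤ K * V := by
    have : b ≤ K * V / m := by
      calc b ≤ _ := hb
        _ ≤ (1 + K / m) * V - V := by linarith
        _ = K * V / m := by ring
    rwa [le_div_iff₀ (by positivity)] at this
  have hb0 : 0 ≤ b := Nat.cast_nonneg _
  push_cast
  nlinarith [mul_le_mul_of_nonneg_right hbm hC, mul_nonneg (mul_nonneg hb0 hC) (sub_nonneg.2 hm')]

theorem abs_ballAvg_mul_sub_le {M : ℝ} (hM : ∀ x, |g x| ≤ M) {K : ℝ} {m : ℕ} (hm : 1 ≤ m)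
    (hK : ((cball S (m + 1)).card : ℝ) ≤ (1 + K / m) * (cball S m).card) {s : Γ} (hs : s ∈ S)
    (x : Γ) : |ballAvg S m g (s * x) - ballAvg S m g x| ≤ 4 * K * M / m := by
  have hM0 : 0 ≤ M := (abs_nonneg _).trans (hM 1)
  have hV := card_cball_pos S m
  have hm' : (1 : ℝ) ≤ m := by exact_mod_cast hm
  have hb := card_image_mul_sdiff_cball_le hs m
  have key : ∀ A : Finset Γ, |∑ t ∈ A, (g (t * x) - g x)| ≤ A.card * (2 * M) := fun A => by
    refine (Finset.abs_sum_le_sum_abs _ _).trans ?_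
    rw [← nsmul_eq_mul]
    refine Finset.sum_le_card_nsmul _ _ _ fun t _ => (abs_sub _ _).trans ?_
    linarith [hM (t * x), hM x]
  rw [ballAvg_mul_sub, abs_mul, abs_of_pos (by positivity), inv_mul_le_iff₀ hV]
  refine (abs_sub _ _).trans ((add_le_add (key _) (key _)).trans ?_)
  rw [card_cball_sdiff_image_mul]
  calc _ = (((cball S m).image (· * s) \ cball S m).card : ℝ) * (4 * M) := by ring
    _ ≤ (K / m * (cball S m).card) * (4 * M) := by
      gcongr
      linarith
    _ = _ := by ring

/-- If infinitely many balls have boundary at most a multiple of their volume divided by their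
radius, then every function with `p`-summable gradient can be approximated. -/
theorem GradApprox.of_frequently_card_cball_le (hPt : P ≠ ⊤) (hP1 : 1 < P.toReal) {K : ℝ}
    (hK : ∃ᶠ m : ℕ in atTop,
      ((cball S (m + 1)).card : ℝ) ≤ (1 + K / m) * (cball S m).card)
    (hg : Memℓp (cayleyGrad S g) P) : GradApprox S P g := by
  refine GradApprox.of_bounded hPt hg fun g hg ⟨M, hM⟩ => ?_
  intro ε hε
  obtain ⟨C, hC⟩ := LpBound.of_memℓp hg
  choose φ hφ hφK using fun n : ℕ => frequently_atTop.1 hK (n + 1)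
  have hφ1 : ∀ n, 1 ≤ φ n := fun n => (Nat.le_add_left 1 n).trans (hφ n)
  obtain ⟨l, hl, hlε⟩ := LpBound.exists_average_le hPt hP1
    (F := fun n => cayleyGrad S (ballAvg S (φ n) g))
    (fun n => hC.cayleyGrad_ballAvg hPt (hφ1 n) (hφK n)) (fun e => by
      refine squeeze_zero_norm
        (fun n => abs_ballAvg_mul_sub_le hM (hφ1 n) (hφK n) e.2.2 e.1) ?_
      refine Tendsto.div_atTop tendsto_const_nhds (tendsto_natCast_atTop_atTop.comp ?_)
      exact tendsto_atTop_mono (fun n => (Nat.le_succ n).trans (hφ n)) tendsto_id) hε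
  have hl0 : (l.length : ℝ) ≠ 0 := by simpa using hl
  refine ⟨fun x => g x - (l.length : ℝ)⁻¹ * (l.map fun n => ballAvg S (φ n) g x).sum, ?_, ?_⟩
  · have hmem : ∀ l : List ℕ,
        Memℓp (fun x => l.length * g x - (l.map fun n => ballAvg S (φ n) g x).sum) P := by
      intro l
      induction l with
      | nil => simpa using zero_mem_ℓp'
      | cons n l ih =>
        convert! (hC.sub_ballAvg hPt (φ n)).memℓp.add ih using 1
        ext x
        simp
        ring
    convert! (hmem l).const_mul (l.length : ℝ)⁻¹ using 1
    ext x
    field_simp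
  · convert! hlε using 1
    ext e
    have hsum : ∀ l : List ℕ, (l.map fun n => cayleyGrad S (ballAvg S (φ n) g) e).sum =
        (l.map fun n => ballAvg S (φ n) g (e.2 * e.1)).sum -
          (l.map fun n => ballAvg S (φ n) g e.1).sum := by
      intro l
      induction l with
      | nil => simp
      | cons n l ih =>
        rw [List.map_cons, List.sum_cons, ih]
        simp only [List.map_cons, List.sum_cons, cayleyGrad]
        ring
    rw [hsum]
    simp only [cayleyGrad]
    ring

end Cayley

theorem inner_single_one {ι : Type*} [DecidableEq ι] (u : lp (fun _ : ι => ℝ) 2) (i : ι) :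
    inner ℝ u (lp.single 2 i (1 : ℝ)) = u i := by
  rw [lp.inner_single_right]
  simp

section Hilbert

variable {Γ : Type*} [Group Γ] (S : Finset Γ)

/-- The subspace of gradients in `ℓ²`. -/
def gradients : Submodule ℝ (lp (fun _ : Γ × S => ℝ) 2) where
  carrier := {u | ∃ h : Γ → ℝ, (u : Γ × S → ℝ) = cayleyGrad S h}
  zero_mem' := ⟨0, by ext; simp [cayleyGrad]⟩
  add_mem' := by
    rintro u v ⟨f, hf⟩ ⟨g, hg⟩
    refine ⟨f + g, ?_⟩
    rw [lp.coeFn_add, hf, hg]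
    ext
    simp only [cayleyGrad, Pi.add_apply]
    ring
  smul_mem' := by
    rintro c u ⟨f, hf⟩
    refine ⟨c • f, ?_⟩
    rw [lp.coeFn_smul, hf]
    ext
    simp only [cayleyGrad, Pi.smul_apply, smul_eq_mul]
    ring

/-- The subspace of gradients of `ℓ²` functions. -/
def lpGradients : Submodule ℝ (lp (fun _ : Γ × S => ℝ) 2) where
  carrier := {u | ∃ h : Γ → ℝ, Memℓp h 2 ∧ (u : Γ × S → ℝ) = cayleyGrad S h}
  zero_mem' := ⟨0, zero_memℓp, by ext; simp [cayleyGrad]⟩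
  add_mem' := by
    rintro u v ⟨f, hf', hf⟩ ⟨g, hg', hg⟩
    refine ⟨f + g, hf'.add hg', ?_⟩
    rw [lp.coeFn_add, hf, hg]
    ext
    simp only [cayleyGrad, Pi.add_apply]
    ring
  smul_mem' := by
    rintro c u ⟨f, hf', hf⟩
    refine ⟨c • f, hf'.const_smul c, ?_⟩
    rw [lp.coeFn_smul, hf]
    ext
    simp only [cayleyGrad, Pi.smul_apply, smul_eq_mul]
    ring

/-- The subspace of gradients of harmonic functions. -/
noncomputable def harmonicGradients : Submodule ℝ (lp (fun _ : Γ × S => ℝ) 2) :=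
  gradients S ⊓ (lpGradients S)ᗮ

theorem lpGradients_le : lpGradients S ≤ gradients S := fun _ ⟨h, _, hu⟩ => ⟨h, hu⟩

variable {S}

/-- Values of potentials are continuous linear functionals of the gradient. -/
theorem exists_potential [DecidableEq Γ] (hgen : Subgroup.closure (S : Set Γ) = ⊤) (x : Γ) :
    ∃ L : lp (fun _ : Γ × S => ℝ) 2 →L[ℝ] ℝ, ∀ (u : lp (fun _ : Γ × S => ℝ) 2) (h : Γ → ℝ),
      (u : Γ × S → ℝ) = cayleyGrad S h → L u = h x - h 1 := by
  have hx : x ∈ Subgroup.closure (S : Set Γ) := hgen ▸ Subgroup.mem_top x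
  induction hx using Subgroup.closure_induction_left with
  | one => exact ⟨0, fun u h _ => by simp⟩
  | mul_left s hs y hy ih =>
    obtain ⟨L, hL⟩ := ih
    refine ⟨L + innerSL ℝ (lp.single 2 (y, (⟨s, hs⟩ : S)) (1 : ℝ)), fun u h hu => ?_⟩
    rw [add_apply, hL u h hu, innerSL_apply_apply, real_inner_comm, inner_single_one, hu]
    simp only [cayleyGrad]
    ring
  | inv_mul_cancel s hs y hy ih =>
    obtain ⟨L, hL⟩ := ih
    refine ⟨L - innerSL ℝ (lp.single 2 (s⁻¹ * y, (⟨s, hs⟩ : S)) (1 : ℝ)), fun u h hu => ?_⟩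
    rw [sub_apply, hL u h hu, innerSL_apply_apply, real_inner_comm, inner_single_one, hu]
    simp only [cayleyGrad, mul_inv_cancel_left]
    ring

theorem isClosed_gradients [DecidableEq Γ] (hgen : Subgroup.closure (S : Set Γ) = ⊤) :
    IsClosed (gradients S : Set (lp (fun _ : Γ × S => ℝ) 2)) := by
  choose L hL using exists_potential hgen
  have : (gradients S : Set (lp (fun _ : Γ × S => ℝ) 2)) =
      ⋂ e : Γ × S, {u | inner ℝ u (lp.single 2 e (1 : ℝ)) = L (e.2 * e.1) u - L e.1 u} := by
    ext u
    simp only [SetLike.mem_coe, Set.mem_iInter, Set.mem_ofPred_eq, inner_single_one]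
    constructor
    · rintro ⟨h, hu⟩ e
      rw [hL _ u h hu, hL _ u h hu, hu, cayleyGrad]
      ring
    · intro hu
      exact ⟨fun x => L x u, funext hu⟩
  rw [this]
  exact isClosed_iInter fun e => isClosed_eq (by fun_prop) (by fun_prop)

theorem isClosed_harmonicGradients [DecidableEq Γ] (hgen : Subgroup.closure (S : Set Γ) = ⊤) :
    IsClosed (harmonicGradients S : Set (lp (fun _ : Γ × S => ℝ) 2)) :=
  (isClosed_gradients hgen).inter (Submodule.isClosed_orthogonal _)

/-- Harmonic gradients are invariant under right translations. -/
theorem exists_translate_mem_harmonicGradients {u : lp (fun _ : Γ × S => ℝ) 2}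
    (hu : u ∈ harmonicGradients S) (γ : Γ) :
    ∃ v ∈ harmonicGradients S, ‖v‖ ≤ ‖u‖ ∧ ∀ e : Γ × S, v e = u (e.1 * γ, e.2) := by
  let τ : Γ × S ≃ Γ × S := (Equiv.mulRight γ).prodCongr (Equiv.refl S)
  obtain ⟨v, hv, hvu⟩ := LpBound.comp_injective (P := 2) ENNReal.ofNat_ne_top
    (⟨u, rfl, le_rfl⟩ : LpBound 2 (u : Γ × S → ℝ) ‖u‖) τ.injective
  have hv' : ∀ e : Γ × S, v e = u (e.1 * γ, e.2) := fun e => congrFun hv e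
  refine ⟨v, ⟨?_, ?_⟩, hvu, hv'⟩
  · obtain ⟨h, hh⟩ := hu.1
    refine ⟨fun x => h (x * γ), ?_⟩
    ext e
    rw [hv', hh]
    simp [cayleyGrad, mul_assoc]
  · rintro w ⟨f, hf, hw⟩
    have hf' : Memℓp (fun x => f (x * γ⁻¹)) 2 := by
      obtain ⟨C, hC⟩ := LpBound.of_memℓp hf
      exact (hC.comp_injective ENNReal.ofNat_ne_top (mul_left_injective γ⁻¹)).memℓp
    obtain ⟨C, hC⟩ := LpBound.of_memℓp hf'
    obtain ⟨w', hw', -⟩ := hC.gradient (S := S) ENNReal.ofNat_ne_top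
    have h0 : inner ℝ w' u = 0 := hu.2 w' ⟨_, hf', hw'⟩
    rw [lp.inner_eq_tsum] at h0 ⊢
    rw [← h0, ← τ.tsum_eq (fun e => inner ℝ (w' e) (u e))]
    refine tsum_congr fun e => ?_
    rw [hv', hw, hw']
    have hτ : τ e = (e.1 * γ, e.2) := rfl
    simp [hτ, cayleyGrad, mul_assoc]

variable [DecidableEq Γ]

/-- The outer vertex boundary of a finite set of group elements. -/
def outerBoundary (S F : Finset Γ) : Finset Γ :=
  S.biUnion fun s => (F.image fun x => s * x) \ F

theorem mem_outerBoundary {F : Finset Γ} {s x : Γ} (hs : s ∈ S) (hx : x ∈ F) (hsx : s * x ∉ F) :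
    s * x ∈ outerBoundary S F :=
  Finset.mem_biUnion.2 ⟨s, hs, Finset.mem_sdiff.2 ⟨Finset.mem_image_of_mem _ hx, hsx⟩⟩

/-- A harmonic function vanishing on the boundary of a finite set has no gradient inside. -/
theorem eq_zero_of_potential_eq_zero (hsym : ∀ s ∈ S, s⁻¹ ∈ S) {F : Finset Γ}
    {u : lp (fun _ : Γ × S => ℝ) 2} (hu : u ∈ (lpGradients S)ᗮ) {h : Γ → ℝ}
    (hh : (u : Γ × S → ℝ) = cayleyGrad S h) (h0 : ∀ y ∈ outerBoundary S F, h y = 0)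
    {e : Γ × S} (he : e.1 ∈ F) : u e = 0 := by
  set k : Γ → ℝ := fun x => if x ∈ F then h x else 0 with hk
  have hk2 : Memℓp k 2 := by
    have : Memℓp k 0 := memℓp_zero (F.finite_toSet.subset fun x hx => by
      by_contra hxF
      exact hx (if_neg hxF))
    exact this.of_exponent_ge zero_le
  obtain ⟨C, hC⟩ := LpBound.of_memℓp hk2
  obtain ⟨w, hw, -⟩ := hC.gradient (S := S) ENNReal.ofNat_ne_top
  have hin : ∀ e : Γ × S, e.1 ∈ F → cayleyGrad S k e = cayleyGrad S h e := by
    rintro ⟨x, s, hs⟩ (hx : x ∈ F)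
    simp only [cayleyGrad, hk, if_pos hx]
    split_ifs with hsx
    · rfl
    · rw [h0 _ (mem_outerBoundary hs hx hsx)]
  have hprod : ∀ e : Γ × S, cayleyGrad S k e * cayleyGrad S h e =
      cayleyGrad S k e * cayleyGrad S k e := by
    rintro ⟨x, s, hs⟩
    by_cases hx : x ∈ F
    · rw [hin _ hx]
    · by_cases hsx : s * x ∈ F
      · have hx' : s⁻¹ * (s * x) ∈ outerBoundary S F :=
          mem_outerBoundary (hsym s hs) hsx (by rwa [inv_mul_cancel_left])
        rw [inv_mul_cancel_left] at hx'
        simp [cayleyGrad, hk, if_neg hx, if_pos hsx, h0 _ hx']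
      · simp [cayleyGrad, hk, if_neg hx, if_neg hsx]
  have hw0 : inner ℝ w w = 0 := by
    rw [← hu w ⟨k, hk2, hw⟩, lp.inner_eq_tsum, lp.inner_eq_tsum]
    refine tsum_congr fun e => ?_
    rw [hw, hh]
    have := hprod e
    simp only [RCLike.inner_apply, conj_trivial]
    linarith
  have hw00 : w = 0 := inner_self_eq_zero.1 hw0
  rw [hh, ← hin e he, ← hw, hw00]
  rfl

/-- The squared norms of the projections to harmonic gradients of the edges in a finite set add up
to at most the size of the boundary. -/
theorem sum_norm_sq_projection_le (hsym : ∀ s ∈ S, s⁻¹ ∈ S)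
    (hgen : Subgroup.closure (S : Set Γ) = ⊤) [(harmonicGradients S).HasOrthogonalProjection]
    (F : Finset Γ) :
    ∑ e ∈ F ×ˢ (Finset.univ : Finset S),
      ‖(harmonicGradients S).starProjection (lp.single 2 e (1 : ℝ))‖ ^ 2 ≤
        (outerBoundary S F).card := by
  classical
  set V := harmonicGradients S
  set Q := F ×ˢ (Finset.univ : Finset S)
  set d : Γ × S → lp (fun _ : Γ × S => ℝ) 2 := fun e => lp.single 2 e (1 : ℝ) with hd
  set U : Submodule ℝ (lp (fun _ : Γ × S => ℝ) 2) :=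
    Submodule.span ℝ ((Q.image fun e => V.starProjection (d e) :) : Set _) with hU
  have hUV : U ≤ V := by
    rw [hU, Submodule.span_le]
    intro y hy
    obtain ⟨e, -, rfl⟩ := Finset.mem_image.1 (Finset.mem_coe.1 hy)
    exact V.starProjection_apply_mem _
  have hinner : ∀ u ∈ V, ∀ e, inner ℝ u (V.starProjection (d e)) = u e := fun u hu e => by
    rw [← V.inner_starProjection_left_eq_right, Submodule.starProjection_eq_self_iff.2 hu,
      inner_single_one]
  have hPU : ∀ e ∈ Q, V.starProjection (d e) ∈ U := fun e he =>
    Submodule.subset_span (Finset.mem_coe.2 (Finset.mem_image_of_mem _ he))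
  have hfin : FiniteDimensional ℝ U := FiniteDimensional.span_finset ℝ _
  have hrank : Module.finrank ℝ U ≤ (outerBoundary S F).card := by
    choose L hL using exists_potential hgen
    let Φ : U →ₗ[ℝ] (outerBoundary S F → ℝ) :=
      LinearMap.pi fun y => (L y).toLinearMap ∘ₗ U.subtype
    have hΦ : Function.Injective Φ := by
      rw [← LinearMap.ker_eq_bot, LinearMap.ker_eq_bot']
      rintro ⟨u, hu⟩ hu0
      obtain ⟨h, hh⟩ := (hUV hu).1
      have hzero : ∀ e ∈ Q, u e = 0 := fun e he =>
        eq_zero_of_potential_eq_zero hsym (F := F) (hUV hu).2 (h := fun x => h x - h 1)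
          (by rw [hh]; ext; simp [cayleyGrad])
          (fun y hy => by
            rw [← hL y u h hh]
            exact congrFun hu0 ⟨y, hy⟩)
          (Finset.mem_product.1 he).1
      have hort : U ≤ (ℝ ∙ u)ᗮ := by
        rw [hU, Submodule.span_le]
        intro y hy
        obtain ⟨e, he, rfl⟩ := Finset.mem_image.1 (Finset.mem_coe.1 hy)
        exact Submodule.mem_orthogonal_singleton_iff_inner_right.2
          ((hinner u (hUV hu) e).trans (hzero e he))
      have := Submodule.mem_orthogonal_singleton_iff_inner_right.1 (hort hu)
      exact Subtype.ext (inner_self_eq_zero.1 this)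
    have := LinearMap.finrank_le_finrank_of_injective hΦ
    simpa using this
  let b := stdOrthonormalBasis ℝ U
  have hexp : ∀ e ∈ Q, ‖V.starProjection (d e)‖ ^ 2 =
      ∑ i, ((b i : U) : lp (fun _ : Γ × S => ℝ) 2) e ^ 2 := fun e he => by
    have h := b.sum_sq_norm_inner_right ⟨_, hPU e he⟩
    rw [Submodule.coe_norm] at h
    rw [← h]
    refine Finset.sum_congr rfl fun i _ => ?_
    rw [Submodule.coe_inner, hinner _ (hUV (b i).2), Real.norm_eq_abs, sq_abs]
  rw [Finset.sum_congr rfl hexp, Finset.sum_comm]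
  refine le_trans ?_ (Nat.cast_le.2 hrank)
  have hone : ∀ i, ∑ e ∈ Q, ((b i : U) : lp (fun _ : Γ × S => ℝ) 2) e ^ 2 ≤ (1 : ℝ) := fun i => by
    have h := lp.sum_rpow_le_norm_rpow (p := 2) (by norm_num)
      ((b i : U) : lp (fun _ : Γ × S => ℝ) 2) Q
    have h1 : ‖((b i : U) : lp (fun _ : Γ × S => ℝ) 2)‖ = 1 := b.orthonormal.1 i
    simpa [h1] using h
  refine (Finset.sum_le_sum fun i _ => hone i).trans ?_
  simp

/-- On an amenable group there are no nonzero harmonic gradients in `ℓ²`. -/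
theorem harmonicGradients_eq_bot (ham : Amenable Γ) (hsym : ∀ s ∈ S, s⁻¹ ∈ S)
    (hgen : Subgroup.closure (S : Set Γ) = ⊤) : harmonicGradients S = ⊥ := by
  have hcomp : CompleteSpace (harmonicGradients S) :=
    (isClosed_harmonicGradients hgen).completeSpace_coe
  set V := harmonicGradients S with hV
  set a : Γ × S → ℝ := fun e => ‖V.starProjection (lp.single 2 e (1 : ℝ))‖ with ha
  have hinner : ∀ u ∈ V, ∀ e, inner ℝ u (V.starProjection (lp.single 2 e (1 : ℝ))) = u e :=
    fun u hu e => by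
      rw [← V.inner_starProjection_left_eq_right, Submodule.starProjection_eq_self_iff.2 hu,
        inner_single_one]
  have hinv : ∀ (x y : Γ) (s : S), a (x, s) ≤ a (y, s) := by
    intro x y s
    set w := V.starProjection (lp.single 2 (x, s) (1 : ℝ))
    have hwV : w ∈ V := V.starProjection_apply_mem _
    obtain ⟨v, hv, hvw, hvu⟩ := exists_translate_mem_harmonicGradients hwV (y⁻¹ * x)
    have h1 : ‖w‖ * ‖w‖ = v (y, s) := by
      rw [← real_inner_self_eq_norm_mul_norm, hinner w hwV, hvu]
      simp
    have h2 : v (y, s) ≤ ‖w‖ * a (y, s) := by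
      rw [← hinner v hv]
      exact (real_inner_le_norm _ _).trans (mul_le_mul_of_nonneg_right hvw (norm_nonneg _))
    change ‖w‖ ≤ _
    rcases (norm_nonneg w).eq_or_lt with h0 | h0
    · rw [← h0]
      exact norm_nonneg _
    · exact le_of_mul_le_mul_left (h1.trans_le h2) h0
  have hsum : ∀ ε : ℝ, 0 < ε → ∑ s : S, a (1, s) ^ 2 ≤ 0 + S.card * ε := by
    intro ε hε
    obtain ⟨F, hF, hFε⟩ := ham S ε hε
    have hF0 : (0 : ℝ) < F.card := by exact_mod_cast hF.card_pos
    have h1 := sum_norm_sq_projection_le hsym hgen F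
    rw [Finset.sum_product] at h1
    have h2 : ∑ x ∈ F, ∑ s : S, a (1, s) ^ 2 ≤ (outerBoundary S F).card := by
      refine le_trans (Finset.sum_le_sum fun x _ => Finset.sum_le_sum fun s _ => ?_) h1
      exact pow_le_pow_left₀ (norm_nonneg _) (hinv 1 x s) 2
    have h3 : ((outerBoundary S F).card : ℝ) ≤ S.card * (ε * F.card) := by
      refine (Nat.cast_le.2 Finset.card_biUnion_le).trans ?_
      rw [Nat.cast_sum, ← nsmul_eq_mul]
      exact Finset.sum_le_card_nsmul _ _ _ hFε
    rw [Finset.sum_const, nsmul_eq_mul] at h2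
    have h4 := h2.trans h3
    rw [zero_add]
    refine le_of_mul_le_mul_left (h4.trans_eq ?_) hF0
    ring
  have hzero : ∑ s : S, a (1, s) ^ 2 ≤ 0 := by
    refine le_of_forall_pos_le_add fun ε hε => ?_
    refine (hsum (ε / (S.card + 1)) (by positivity)).trans ?_
    rw [zero_add, zero_add, mul_div_assoc', div_le_iff₀ (by positivity)]
    linarith
  have ha0 : ∀ e, a e = 0 := by
    rintro ⟨x, s⟩
    have h1 : a (1, s) ^ 2 ≤ 0 :=
      (Finset.single_le_sum (f := fun s : S => a (1, s) ^ 2) (fun s _ => sq_nonneg _)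
        (Finset.mem_univ s)).trans hzero
    have h2 : a (1, s) = 0 := pow_eq_zero_iff two_ne_zero |>.1 (le_antisymm h1 (sq_nonneg _))
    exact le_antisymm ((hinv x 1 s).trans h2.le) (norm_nonneg _)
  rw [Submodule.eq_bot_iff]
  intro u hu
  ext e
  rw [← hinner u hu e, norm_eq_zero.1 (ha0 e), inner_zero_right]
  rfl

/-- On an amenable group, every function with square summable gradient can be approximated. -/
theorem GradApprox.two_of_amenable (ham : Amenable Γ) (hsym : ∀ s ∈ S, s⁻¹ ∈ S)
    (hgen : Subgroup.closure (S : Set Γ) = ⊤) {g : Γ → ℝ} (hg : Memℓp (cayleyGrad S g) 2) :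
    GradApprox S 2 g := by
  set W := (lpGradients S).topologicalClosure with hW
  have hWc : CompleteSpace W :=
    (Submodule.isClosed_topologicalClosure (lpGradients S)).completeSpace_coe
  let G : lp (fun _ : Γ × S => ℝ) 2 := ⟨cayleyGrad S g, hg⟩
  have hG : G ∈ gradients S := ⟨g, rfl⟩
  have hWg : W ≤ gradients S :=
    Submodule.topologicalClosure_minimal _ (lpGradients_le S) (isClosed_gradients hgen)
  have hmem : G - W.starProjection G ∈ harmonicGradients S := by
    refine ⟨(gradients S).sub_mem hG (hWg (W.starProjection_apply_mem G)), ?_⟩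
    exact Submodule.orthogonal_le (Submodule.le_topologicalClosure _)
      (W.sub_starProjection_mem_orthogonal G)
  rw [harmonicGradients_eq_bot ham hsym hgen, Submodule.mem_bot, sub_eq_zero] at hmem
  have hGW : G ∈ W := hmem ▸ W.starProjection_apply_mem G
  intro ε hε
  obtain ⟨w, ⟨f, hf, hwf⟩, hd⟩ := Metric.mem_closure_iff.1 hGW ε hε
  refine ⟨f, hf, G - w, ?_, ?_⟩
  · rw [lp.coeFn_sub, hwf]
    ext e
    simp only [G, Pi.sub_apply, cayleyGrad]
    ring
  · rw [← dist_eq_norm]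
    exact hd.le

end Hilbert

section Growth

variable {Γ : Type*} [Group Γ] [DecidableEq Γ] {S : Finset Γ} {f g : Γ → ℝ} {C D M a : ℝ}

theorem abs_ballAvg_le (hM : ∀ x, |f x| ≤ M) (m : ℕ) (x : Γ) : |ballAvg S m f x| ≤ M := by
  have hV := card_cball_pos S m
  rw [ballAvg, abs_mul, abs_of_pos (inv_pos.2 hV), inv_mul_le_iff₀ hV, ← nsmul_eq_mul]
  exact (Finset.abs_sum_le_sum_abs _ _).trans (Finset.sum_le_card_nsmul _ _ _ fun t _ => hM _)

theorem ballAvg_sub (m : ℕ) (f g : Γ → ℝ) (x : Γ) :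
    ballAvg S m (fun y => f y - g y) x = ballAvg S m f x - ballAvg S m g x := by
  simp only [ballAvg, Finset.sum_sub_distrib, mul_sub]

/-- Averages of square summable functions over large balls are small. -/
theorem LpBound.abs_ballAvg_le_div (hf : LpBound 2 f D) (ha : 0 < a) {m : ℕ} (hm : 0 < m)
    (hV : a ^ 2 * (m : ℝ) ^ 4 ≤ (cball S m).card) (x : Γ) :
    |ballAvg S m f x| ≤ D / (a * (m : ℝ) ^ 2) := by
  have hD := hf.nonneg
  have hm' : (0 : ℝ) < m := by exact_mod_cast hm
  have hV0 := card_cball_pos S m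
  have h1 := (hf.comp_injective ENNReal.ofNat_ne_top (mul_left_injective x)).sum_rpow_le
    ENNReal.ofNat_ne_top (cball S m)
  simp only [ENNReal.toReal_ofNat, Real.rpow_ofNat, sq_abs] at h1
  have h2 := sq_sum_le_card_mul_sum_sq (s := cball S m) (f := fun t => f (t * x))
  have h3 : (cball S m).card * ballAvg S m f x = ∑ t ∈ cball S m, f (t * x) := by
    rw [ballAvg, mul_inv_cancel_left₀ hV0.ne']
  rw [← h3] at h2
  have h4 : (cball S m).card * ballAvg S m f x ^ 2 ≤ D ^ 2 := by
    refine le_of_mul_le_mul_left ?_ hV0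
    calc ((cball S m).card : ℝ) * ((cball S m).card * ballAvg S m f x ^ 2)
        = (((cball S m).card : ℝ) * ballAvg S m f x) ^ 2 := by ring
      _ ≤ _ := h2
      _ ≤ _ := by gcongr
  rw [le_div_iff₀ (by positivity)]
  refine abs_le_of_sq_le_sq' ?_ hD |>.2
  rw [mul_pow, sq_abs]
  calc ballAvg S m f x ^ 2 * (a * (m : ℝ) ^ 2) ^ 2
      = a ^ 2 * (m : ℝ) ^ 4 * ballAvg S m f x ^ 2 := by ring
    _ ≤ (cball S m).card * ballAvg S m f x ^ 2 := by gcongr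
    _ ≤ D ^ 2 := h4

/-- Iterated averages over balls of dyadic radii. -/
noncomputable def dyadicAvg (S : Finset Γ) : ℕ → (Γ → ℝ) → Γ → ℝ
  | 0, f => f
  | k + 1, f => dyadicAvg S k (ballAvg S (2 ^ k) f)

theorem abs_dyadicAvg_le (k : ℕ) : ∀ {f : Γ → ℝ}, (∀ x, |f x| ≤ M) →
    ∀ x, |dyadicAvg S k f x| ≤ M := by
  induction k with
  | zero => exact fun h => h
  | succ k ih => exact fun h => ih (abs_ballAvg_le h _)

theorem dyadicAvg_sub (k : ℕ) : ∀ (f g : Γ → ℝ) (x : Γ),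
    dyadicAvg S k (fun y => f y - g y) x = dyadicAvg S k f x - dyadicAvg S k g x := by
  induction k with
  | zero => exact fun f g x => rfl
  | succ k ih =>
    intro f g x
    simp only [dyadicAvg]
    rw [← ih, funext (ballAvg_sub (S := S) (2 ^ k) f g)]

theorem LpBound.abs_dyadicAvg_succ_le (hf : LpBound 2 f D) (ha : 0 < a)
    (hV : ∀ m : ℕ, a ^ 2 * (m : ℝ) ^ 4 ≤ (cball S m).card) (k : ℕ) (x : Γ) :
    |dyadicAvg S (k + 1) f x| ≤ D / (a * (2 ^ k) ^ 2) := by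
  have h := fun x => hf.abs_ballAvg_le_div ha (Nat.two_pow_pos k) (hV (2 ^ k)) x
  push_cast at h
  exact abs_dyadicAvg_le k h x

theorem LpBound.abs_sub_dyadicAvg_le (h : LpBound 2 (cayleyGrad S f) C) (ha : 0 < a)
    (hV : ∀ m : ℕ, a ^ 2 * (m : ℝ) ^ 4 ≤ (cball S m).card) (k : ℕ) (x : Γ) :
    |f x - dyadicAvg S (k + 1) f x| ≤ C + 4 * C / a * (1 - (1 / 2) ^ k) := by
  induction k with
  | zero =>
    have := (h.sub_ballAvg ENNReal.ofNat_ne_top 1).abs_le x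
    simpa [dyadicAvg] using this
  | succ k ih =>
    have h1 := (h.sub_ballAvg ENNReal.ofNat_ne_top (2 ^ (k + 1))).abs_dyadicAvg_succ_le ha hV k x
    rw [dyadicAvg_sub] at h1
    have h2 := abs_sub_le (f x) (dyadicAvg S (k + 1) f x) (dyadicAvg S (k + 1 + 1) f x)
    refine (h2.trans (add_le_add ih h1)).trans_eq ?_
    push_cast
    rw [one_div, inv_pow, inv_pow]
    field_simp
    ring

/-- On a group of growth at least quartic, square summable functions are uniformly bounded by
their gradient. -/
theorem LpBound.abs_le_of_gradient (h : LpBound 2 (cayleyGrad S f) C) (hf : Memℓp f 2)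
    (ha : 0 < a) (hV : ∀ m : ℕ, a ^ 2 * (m : ℝ) ^ 4 ≤ (cball S m).card) (x : Γ) :
    |f x| ≤ (1 + 4 / a) * C := by
  have hC := h.nonneg
  obtain ⟨D, hD⟩ := LpBound.of_memℓp hf
  have hD0 := hD.nonneg
  have hlim : Tendsto (fun k : ℕ => (1 + 4 / a) * C + D / a * (1 / 2) ^ k) atTop
      (𝓝 ((1 + 4 / a) * C + D / a * 0)) :=
    ((tendsto_pow_atTop_nhds_zero_of_lt_one (by norm_num) (by norm_num)).const_mul _).const_add _
  rw [mul_zero, add_zero] at hlim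
  refine ge_of_tendsto' hlim fun k => ?_
  have h1 := h.abs_sub_dyadicAvg_le ha hV k x
  have h2 := hD.abs_dyadicAvg_succ_le ha hV k x
  have h3 : |f x| ≤ |f x - dyadicAvg S (k + 1) f x| + |dyadicAvg S (k + 1) f x| := by
    simpa using abs_add_le (f x - dyadicAvg S (k + 1) f x) (dyadicAvg S (k + 1) f x)
  have h4 : D / (a * (2 ^ k) ^ 2) ≤ D / a * (1 / 2) ^ k := by
    rw [← div_div, div_pow, one_pow, mul_one_div]
    exact div_le_div_of_nonneg_left (by positivity) (by positivity)
      (le_self_pow₀ (one_le_pow₀ one_le_two) two_ne_zero)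
  have h5 : 4 * C / a * (1 - (1 / 2) ^ k) ≤ 4 / a * C := by
    have : 0 ≤ 4 * C / a * (1 / 2) ^ k := by positivity
    calc 4 * C / a * (1 - (1 / 2) ^ k) = 4 / a * C - 4 * C / a * (1 / 2) ^ k := by ring
      _ ≤ _ := by linarith
  linarith

theorem exists_card_cball_ge (h : ∀ᶠ m : ℕ in atTop,
    (1 + 15 / m) * ((cball S m).card : ℝ) < (cball S (m + 1)).card) :
    ∃ a : ℝ, 0 < a ∧ ∀ m : ℕ, a ^ 2 * (m : ℝ) ^ 4 ≤ (cball S m).card := by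
  obtain ⟨N, hN⟩ := eventually_atTop.1 h
  have hN0 : (0 : ℝ) < (N + 1 : ℕ) := by positivity
  refine ⟨(((N + 1 : ℕ) : ℝ) ^ 2)⁻¹, by positivity, fun m => ?_⟩
  have hsmall : ∀ m : ℕ, m ≤ N + 1 →
      ((((N + 1 : ℕ) : ℝ) ^ 2)⁻¹) ^ 2 * (m : ℝ) ^ 4 ≤ (cball S m).card := fun m hm => by
    have h1 : (1 : ℝ) ≤ (cball S m).card := by exact_mod_cast Nat.cast_pos.1 (card_cball_pos S m)
    refine le_trans ?_ h1
    rw [inv_pow, ← pow_mul, inv_mul_le_iff₀ (by positivity), mul_one]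
    have : (m : ℝ) ≤ (N + 1 : ℕ) := by exact_mod_cast hm
    gcongr
  rcases le_total m (N + 1) with hm | hm
  · exact hsmall m hm
  · induction m, hm using Nat.le_induction with
    | base => exact hsmall _ le_rfl
    | succ m hm ih =>
      have hm1 : (1 : ℝ) ≤ m := by exact_mod_cast (Nat.le_add_left 1 N).trans hm
      refine le_trans ?_ (hN m ((Nat.le_succ N).trans hm)).le
      have h1 : ((m + 1 : ℕ) : ℝ) ^ 4 ≤ (1 + 15 / m) * (m : ℝ) ^ 4 := by
        have : (1 + 15 / (m : ℝ)) * (m : ℝ) ^ 4 = (m : ℝ) ^ 4 + 15 * (m : ℝ) ^ 3 := by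
          field_simp
        rw [this]
        push_cast
        nlinarith [mul_nonneg (sub_nonneg.2 hm1) (sq_nonneg (m : ℝ)),
          mul_nonneg (sub_nonneg.2 hm1) (by linarith : (0 : ℝ) ≤ m)]
      calc _ ≤ ((((N + 1 : ℕ) : ℝ) ^ 2)⁻¹) ^ 2 * ((1 + 15 / m) * (m : ℝ) ^ 4) := by gcongr
        _ = (1 + 15 / m) * (((((N + 1 : ℕ) : ℝ) ^ 2)⁻¹) ^ 2 * (m : ℝ) ^ 4) := by ring
        _ ≤ _ := by gcongr

theorem Memℓp.tendsto_cofinite_zero {ι : Type*} {f : ι → ℝ} (hf : Memℓp f 2) :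
    Tendsto f cofinite (𝓝 0) := by
  have h := (hf.summable (by norm_num)).tendsto_cofinite_zero
  simp only [ENNReal.toReal_ofNat, Real.rpow_ofNat] at h
  have h' := h.sqrt
  simp only [Real.sqrt_sq (norm_nonneg _), Real.sqrt_zero] at h'
  exact tendsto_zero_iff_norm_tendsto_zero.2 h'

/-- On a group of growth at least quartic, a function with square summable gradient which can be
approximated has a limit at infinity. -/
theorem GradApprox.exists_tendsto_cofinite (hgen : Subgroup.closure (S : Set Γ) = ⊤)
    (hg : GradApprox S 2 g) (ha : 0 < a)
    (hV : ∀ m : ℕ, a ^ 2 * (m : ℝ) ^ 4 ≤ (cball S m).card) :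
    ∃ c, Tendsto g cofinite (𝓝 c) := by
  set K : ℝ := 1 + 4 / a with hK
  have hK0 : 0 < K := by positivity
  choose F hF hFg using fun n : ℕ => hg (1 / ((n : ℝ) + 1)) (by positivity)
  have hsub : ∀ n m x, |F n x - F m x| ≤ K * (1 / ((m : ℝ) + 1) + 1 / ((n : ℝ) + 1)) := by
    intro n m x
    refine LpBound.abs_le_of_gradient (f := fun x => F n x - F m x) ?_ ((hF n).sub (hF m)) ha hV x
    convert! (hFg m).sub (hFg n) using 2 with e
    simp only [cayleyGrad]
    ring
  have hlim0 : Tendsto (fun n : ℕ => 1 / ((n : ℝ) + 1)) atTop (𝓝 0) :=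
    tendsto_one_div_add_atTop_nhds_zero_nat
  have hcauchy : CauchySeq fun n => F n 1 := by
    refine cauchySeq_of_le_tendsto_0 (fun n : ℕ => K * (1 / ((n : ℝ) + 1) + 1 / ((n : ℝ) + 1)))
      (fun n m N hn hm => (hsub n m 1).trans ?_) ?_
    · gcongr
    · simpa using (hlim0.add hlim0).const_mul K
  obtain ⟨b, hb⟩ := cauchySeq_tendsto_of_complete hcauchy
  have hpt : ∀ x, Tendsto (fun n => F n x) atTop (𝓝 (g x - (g 1 - b))) := by
    intro x
    obtain ⟨L, hL⟩ := exists_potential hgen x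
    have h0 : Tendsto (fun n => (g x - F n x) - (g 1 - F n 1)) atTop (𝓝 0) := by
      refine squeeze_zero_norm (a := fun n : ℕ => ‖L‖ * (1 / ((n : ℝ) + 1))) (fun n => ?_)
        (by simpa using hlim0.const_mul ‖L‖)
      obtain ⟨u, hu, hun⟩ := hFg n
      rw [← hL u _ hu]
      exact L.le_opNorm_of_le hun
    have h1 := ((tendsto_const_nhds (x := g x - g 1)).add hb).sub h0
    convert! h1 using 2 <;> ring
  refine ⟨g 1 - b, Metric.tendsto_nhds.2 fun ε hε => ?_⟩
  obtain ⟨n, hn⟩ := ((hlim0.const_mul K).eventually_lt_const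
    (show K * 0 < ε / 2 by rw [mul_zero]; positivity)).exists
  have hle : ∀ x, |g x - (g 1 - b) - F n x| ≤ ε / 2 := fun x => by
    have h1 : Tendsto (fun m : ℕ => K * (1 / ((n : ℝ) + 1) + 1 / ((m : ℝ) + 1))) atTop
        (𝓝 (K * (1 / ((n : ℝ) + 1) + 0))) := (hlim0.const_add _).const_mul K
    rw [add_zero] at h1
    exact (le_of_tendsto_of_tendsto' ((hpt x).sub_const (F n x)).abs h1
      fun m => hsub m n x).trans hn.le
  filter_upwards [Metric.tendsto_nhds.1 (hF n).tendsto_cofinite_zero (ε / 2) (by positivity)]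
    with x hx
  rw [Real.dist_eq, sub_zero] at hx
  rw [Real.dist_eq]
  have := abs_add_le (g x - (g 1 - b) - F n x) (F n x)
  rw [sub_add_cancel] at this
  linarith [hle x]

/-- On an amenable group, every function with `p`-summable gradient, `1 < p ≤ 2`, can be
approximated. -/
theorem GradApprox.of_amenable {P : ℝ≥0∞} [hP : Fact (1 ≤ P)] (hP1 : 1 < P.toReal) (hP2 : P ≤ 2)
    (ham : Amenable Γ) (hsym : ∀ s ∈ S, s⁻¹ ∈ S) (hgen : Subgroup.closure (S : Set Γ) = ⊤)
    (hg : Memℓp (cayleyGrad S g) P) : GradApprox S P g := by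
  have hPt : P ≠ ⊤ := (hP2.trans_lt ENNReal.ofNat_lt_top).ne
  by_cases hfreq : ∃ᶠ m : ℕ in atTop,
      ((cball S (m + 1)).card : ℝ) ≤ (1 + 15 / m) * (cball S m).card
  · exact GradApprox.of_frequently_card_cball_le hPt hP1 hfreq hg
  · simp only [not_frequently, not_le] at hfreq
    obtain ⟨a, ha, hV⟩ := exists_card_cball_ge hfreq
    obtain ⟨c, hc⟩ := (GradApprox.two_of_amenable ham hsym hgen
      (hg.of_exponent_ge hP2)).exists_tendsto_cofinite hgen ha hV
    exact GradApprox.of_tendsto_cofinite hPt hg hc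

end Growth

section CayleyGraph

variable {Γ : Type*} [Group Γ] [DecidableEq Γ] {S : Finset Γ} {hsym : ∀ s ∈ S, s⁻¹ ∈ S}
  {h1 : (1 : Γ) ∉ S} {p : ℝ}

/-- The oriented edges of a Cayley graph are labelled by their origin and a generator. -/
def cayleyEdgeEquiv : Γ × S ≃ (cayley S hsym h1).Edge where
  toFun e := ⟨(e.1, e.2 * e.1), Finset.mem_image_of_mem _ e.2.2⟩
  invFun e := (e.1.1, ⟨e.1.2 * e.1.1⁻¹, by
    obtain ⟨s, hs, h⟩ := Finset.mem_image.1 e.2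
    rw [← h, mul_inv_cancel_right]
    exact hs⟩)
  left_inv e := by simp
  right_inv e := by simp

theorem memDp_iff_memℓp (hp : 0 < p) (g : Γ → ℝ) :
    (cayley S hsym h1).MemDp p g ↔ Memℓp (cayleyGrad S g) (ENNReal.ofReal p) := by
  have hp' : (ENNReal.ofReal p).toReal = p := ENNReal.toReal_ofReal hp.le
  rw [memℓp_gen_iff (by rwa [hp']), hp', LFGraph.MemDp, lpMem,
    ← (cayleyEdgeEquiv (hsym := hsym) (h1 := h1)).summable_iff]
  rfl

theorem LpBound.gradNorm_le (hp : 1 ≤ p) {g : Γ → ℝ} {C : ℝ}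
    (h : LpBound (ENNReal.ofReal p) (cayleyGrad S g) C) :
    (cayley S hsym h1).gradNorm p g ≤ C := by
  have hp' : (ENNReal.ofReal p).toReal = p := ENNReal.toReal_ofReal (zero_le_one.trans hp)
  obtain ⟨u, hu, huC⟩ := h
  refine le_of_eq_of_le ?_ huC
  rw [lp.norm_eq_tsum_rpow (by rw [hp']; positivity), hp', LFGraph.gradNorm,
    ← (cayleyEdgeEquiv (hsym := hsym) (h1 := h1)).tsum_eq, hu]
  rfl

end CayleyGraph

/-- Every finitely generated amenable group has trivial reduced
`ℓ^p`-cohomology in degree one for all `p ∈ (1,2]`. -/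
theorem stmt5 {Γ : Type*} [Group Γ] [DecidableEq Γ] (ham : Amenable Γ)
    (S : Finset Γ) (hsym : ∀ s ∈ S, s⁻¹ ∈ S) (h1 : (1 : Γ) ∉ S)
    (hgen : Subgroup.closure (S : Set Γ) = ⊤)
    (p : ℝ) (hp1 : 1 < p) (hp2 : p ≤ 2) (e0 : Γ)
    (g : Γ → ℝ) (hg : (cayley S hsym h1).MemDp p g) :
    (cayley S hsym h1).InClos p e0 g := by
  have hp0 : 0 < p := zero_lt_one.trans hp1
  have hp' : (ENNReal.ofReal p).toReal = p := ENNReal.toReal_ofReal hp0.le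
  have : Fact (1 ≤ ENNReal.ofReal p) := ⟨by simpa using hp1.le⟩
  have happ : GradApprox S (ENNReal.ofReal p) g :=
    GradApprox.of_amenable (by rwa [hp']) (by simpa using ENNReal.ofReal_le_ofReal hp2) ham hsym
      hgen ((memDp_iff_memℓp hp0 g).1 hg)
  intro ε hε
  obtain ⟨f, hf, hgf⟩ := happ (ε / 2) (half_pos hε)
  have hgrad : LpBound (ENNReal.ofReal p)
      (cayleyGrad S fun x => g x - (f x + (g e0 - f e0))) (ε / 2) := by
    convert! hgf using 1
    ext e
    simp only [cayleyGrad]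
    ring
  refine ⟨f, g e0 - f e0, ?_, (memDp_iff_memℓp hp0 _).2 hgrad.memℓp, ?_⟩
  · have := hf.summable (by rwa [hp'])
    rwa [hp'] at this
  · rw [LFGraph.dpDist, add_sub_cancel, sub_self, abs_zero, add_zero]
    exact (hgrad.gradNorm_le hp1.le).trans_lt (half_lt_self hε)
end

section
/- Let Γ be a graph satisfying the d-dimensional isoperimetric profile IS_d such that for some p with 1 ≤ p < d/2 the reduced ℓ^p-cohomology of Γ in degree one is non-trivial. Then every graph Γ' of bounded valency that is quasi-isometric to Γ has a non-trivial Poisson boundary, i.e. Γ' admits a non-constant bounded harmonic function for the simple random walk. -/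
open scoped BigOperators ENNReal NNReal
open Filter Topology

namespace LFGraph

section Distance

variable {X : Type*} {G : LFGraph X}

theorem reachN_trans {m n : ℕ} {x y z : X} (h : G.reachN m x y) (h' : G.reachN n y z) :
    G.reachN (m + n) x z := by
  induction m generalizing x with
  | zero =>
    have hx : y = x := h
    subst hx
    simpa using h'
  | succ m ih =>
    obtain ⟨w, hw, hwy⟩ := h
    rw [Nat.succ_add]
    exact ⟨w, hw, ih hwy⟩

theorem reachN_one {x y : X} (h : y ∈ G.nbr x) : G.reachN 1 x y := ⟨y, h, rfl⟩

theorem reachN_symm {n : ℕ} {x y : X} (h : G.reachN n x y) : G.reachN n y x := by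
  induction n generalizing x with
  | zero => exact Eq.symm h
  | succ n ih =>
    obtain ⟨z, hz, hzy⟩ := h
    exact reachN_trans (ih hzy) (reachN_one ((G.symm x z).1 hz))

theorem Conn.exists_reachN (hG : G.Conn) (x y : X) : ∃ n, G.reachN n x y := by
  induction hG x y with
  | refl => exact ⟨0, rfl⟩
  | tail _ h ih =>
    obtain ⟨n, hn⟩ := ih
    exact ⟨n + 1, reachN_trans hn (reachN_one h)⟩

theorem Conn.reachN_gdist (hG : G.Conn) (x y : X) : G.reachN (G.gdist x y) x y :=
  Nat.sInf_mem (s := {n : ℕ | G.reachN n x y}) (hG.exists_reachN x y)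

theorem gdist_le {n : ℕ} {x y : X} (h : G.reachN n x y) : G.gdist x y ≤ n :=
  Nat.sInf_le (s := {n : ℕ | G.reachN n x y}) h

theorem gdist_le_one {x y : X} (h : y ∈ G.nbr x) : G.gdist x y ≤ 1 :=
  gdist_le (reachN_one h)

theorem gdist_self (x : X) : G.gdist x x = 0 :=
  Nat.le_zero.1 (gdist_le (n := 0) rfl)

theorem Conn.gdist_comm (hG : G.Conn) (x y : X) : G.gdist x y = G.gdist y x :=
  le_antisymm (gdist_le (reachN_symm (hG.reachN_gdist y x)))
    (gdist_le (reachN_symm (hG.reachN_gdist x y)))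

theorem Conn.gdist_triangle (hG : G.Conn) (x y z : X) :
    G.gdist x z ≤ G.gdist x y + G.gdist y z :=
  gdist_le (reachN_trans (hG.reachN_gdist x y) (hG.reachN_gdist y z))

open Classical in
/-- The finite set of vertices reachable from `x` in exactly `n` steps. -/
noncomputable def sphere (G : LFGraph X) : ℕ → X → Finset X
  | 0, x => {x}
  | n + 1, x => (G.nbr x).biUnion (sphere G n)

theorem mem_sphere {n : ℕ} {x y : X} : y ∈ G.sphere n x ↔ G.reachN n x y := by
  induction n generalizing x with
  | zero => simp [sphere, reachN]
  | succ n ih => simp [sphere, reachN, ih]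

theorem card_sphere_le {D : ℕ} (hD : G.BddVal D) (n : ℕ) (x : X) :
    (G.sphere n x).card ≤ D ^ n := by
  classical
  induction n generalizing x with
  | zero => simp [sphere]
  | succ n ih =>
    calc (G.sphere (n + 1) x).card ≤ (G.nbr x).card * D ^ n :=
          Finset.card_biUnion_le_card_mul _ _ _ fun y _ => ih y
      _ ≤ D * D ^ n := Nat.mul_le_mul_right _ (hD x)
      _ = D ^ (n + 1) := by ring

theorem Conn.exists_ball_card_le (hG : G.Conn) {D : ℕ} (hD : G.BddVal D) (R : ℕ) :
    ∃ N : ℕ, ∀ x, ∃ s : Finset X, s.card ≤ N ∧ ∀ y, G.gdist x y ≤ R → y ∈ s := by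
  classical
  refine ⟨∑ n ∈ Finset.range (R + 1), D ^ n, fun x =>
    ⟨(Finset.range (R + 1)).biUnion fun n => G.sphere n x, ?_, fun y hy => ?_⟩⟩
  · exact Finset.card_biUnion_le.trans (Finset.sum_le_sum fun n _ => card_sphere_le hD n x)
  · exact Finset.mem_biUnion.2
      ⟨_, Finset.mem_range.2 (Nat.lt_succ_of_le hy), mem_sphere.2 (hG.reachN_gdist x y)⟩

end Distance

/-- The fibres of `F` have at most `N` elements. -/
def FibreBound {X Y : Type*} (F : X → Y) (N : ℕ) : Prop :=
  ∀ y, ∃ s : Finset X, s.card ≤ N ∧ ∀ x, F x = y → x ∈ s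

theorem Conn.exists_fibreBound {X Y : Type*} {G : LFGraph X} (hG : G.Conn) {D : ℕ}
    (hD : G.BddVal D) {F : X → Y} {R : ℕ} (hF : ∀ x x', F x = F x' → G.gdist x x' ≤ R) :
    ∃ N, FibreBound F N := by
  obtain ⟨N, hN⟩ := hG.exists_ball_card_le hD R
  refine ⟨N, fun y => ?_⟩
  by_cases hy : ∃ x, F x = y
  · obtain ⟨x, rfl⟩ := hy
    obtain ⟨s, hs, hs'⟩ := hN x
    exact ⟨s, hs, fun x' hx' => hs' x' (hF x x' hx'.symm)⟩
  · exact ⟨∅, by simp, fun x hx => (hy ⟨x, hx⟩).elim⟩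

theorem FibreBound.tsum_comp_le {X Y : Type*} {F : X → Y} {N : ℕ} (hF : FibreBound F N)
    (b : Y → ℝ≥0∞) : ∑' x, b (F x) ≤ N * ∑' y, b y := by
  classical
  calc ∑' x, b (F x) = ∑' x, ∑' y, (if F x = y then b y else 0) :=
        tsum_congr fun x => by rw [tsum_eq_single (F x)] <;> simp +contextual [eq_comm]
    _ = ∑' y, ∑' x, (if F x = y then b y else 0) := ENNReal.tsum_comm
    _ ≤ ∑' y, N * b y := by
        refine ENNReal.tsum_le_tsum fun y => ?_
        obtain ⟨s, hs, hs'⟩ := hF y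
        rw [tsum_eq_sum (s := s) fun x hx => if_neg fun h => hx (hs' x h)]
        calc ∑ x ∈ s, (if F x = y then b y else 0) ≤ ∑ _x ∈ s, b y :=
              Finset.sum_le_sum fun x _ => by split_ifs <;> simp
          _ = s.card * b y := by simp
          _ ≤ N * b y := by gcongr
    _ = N * ∑' y, b y := ENNReal.tsum_mul_left

theorem FibreBound.finite_preimage {X Y : Type*} {F : X → Y} {N : ℕ} (hF : FibreBound F N)
    {A : Set Y} (hA : A.Finite) : (F ⁻¹' A).Finite :=
  hA.preimage' fun y _ => by
    obtain ⟨s, -, hs⟩ := hF y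
    exact s.finite_toSet.subset fun x hx => hs x hx

section Energy

variable {X : Type*} {G : LFGraph X}

theorem tsum_sum_nbr_comm (G : LFGraph X) (c : X → X → ℝ≥0∞) :
    ∑' x, ∑ y ∈ G.nbr x, c x y = ∑' y, ∑ x ∈ G.nbr y, c x y := by
  classical
  have key : ∀ (c : X → X → ℝ≥0∞) (x : X),
      ∑ y ∈ G.nbr x, c x y = ∑' y, if y ∈ G.nbr x then c x y else 0 := fun c x => by
    rw [tsum_eq_sum (s := G.nbr x) fun y hy => if_neg hy]
    exact Finset.sum_congr rfl fun y hy => (if_pos hy).symm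
  simp_rw [key c, fun y => key (fun y x => c x y) y]
  rw [ENNReal.tsum_comm]
  simp_rw [fun x y => G.symm x y]

theorem tsum_sum_nbr_le {D : ℕ} (hD : G.BddVal D) (c : X → ℝ≥0∞) :
    ∑' x, ∑ y ∈ G.nbr x, c y ≤ D * ∑' x, c x := by
  rw [G.tsum_sum_nbr_comm fun _ y => c y, ← ENNReal.tsum_mul_left]
  refine ENNReal.tsum_le_tsum fun x => ?_
  simp only [Finset.sum_const, nsmul_eq_mul]
  gcongr
  exact hD x

/-- The `r`-th power sum of the gradient of `w` over all oriented edges. -/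
noncomputable def energy (G : LFGraph X) (r : ℝ) (w : X → ℝ) : ℝ≥0∞ :=
  ∑' x, ∑ y ∈ G.nbr x, ENNReal.ofReal |w y - w x| ^ r

/-- The total variation of `w` along all paths of length at most `n` starting at `x`. -/
noncomputable def locGrad (G : LFGraph X) (w : X → ℝ) : ℕ → X → ℝ≥0∞
  | 0, _ => 0
  | n + 1, x => ∑ y ∈ G.nbr x, (ENNReal.ofReal |w y - w x| + locGrad G w n y)

theorem ofReal_abs_sub_le_locGrad (w : X → ℝ) {n : ℕ} {x y : X} (h : G.reachN n x y) :
    ENNReal.ofReal |w y - w x| ≤ G.locGrad w n x := by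
  induction n generalizing x with
  | zero =>
    have hx : y = x := h
    simp [hx]
  | succ n ih =>
    obtain ⟨z, hz, hzy⟩ := h
    calc ENNReal.ofReal |w y - w x| ≤ ENNReal.ofReal (|w z - w x| + |w y - w z|) := by
          apply ENNReal.ofReal_le_ofReal
          rw [add_comm]
          exact abs_sub_le _ _ _
      _ = ENNReal.ofReal |w z - w x| + ENNReal.ofReal |w y - w z| :=
          ENNReal.ofReal_add (abs_nonneg _) (abs_nonneg _)
      _ ≤ ENNReal.ofReal |w z - w x| + G.locGrad w n z := by gcongr; exact ih hzy
      _ ≤ _ := Finset.single_le_sum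
          (f := fun y => ENNReal.ofReal |w y - w x| + G.locGrad w n y) (fun _ _ => zero_le) hz

theorem locGrad_mono (w : X → ℝ) (x : X) : Monotone fun n => G.locGrad w n x := by
  refine monotone_nat_of_le_succ fun n => ?_
  induction n generalizing x with
  | zero => exact zero_le
  | succ n ih => exact Finset.sum_le_sum fun y _ => add_le_add_right (ih y) _

theorem Conn.ofReal_abs_sub_le_locGrad (hG : G.Conn) (w : X → ℝ) {n : ℕ} {x y : X}
    (h : G.gdist x y ≤ n) : ENNReal.ofReal |w y - w x| ≤ G.locGrad w n x :=
  (LFGraph.ofReal_abs_sub_le_locGrad w (hG.reachN_gdist x y)).trans (locGrad_mono w x h)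

theorem exists_tsum_locGrad_rpow_le {D : ℕ} (hD : G.BddVal D) {r : ℝ} (hr : 1 ≤ r) (n : ℕ) :
    ∃ K : ℝ≥0, ∀ w : X → ℝ, ∑' x, G.locGrad w n x ^ r ≤ K * G.energy r w := by
  have hr0 : 0 < r := by linarith
  have hr1 : 0 ≤ r - 1 := by linarith
  induction n with
  | zero => exact ⟨0, fun w => by simp [locGrad, hr0]⟩
  | succ n ih =>
    obtain ⟨K, hK⟩ := ih
    refine ⟨(D : ℝ≥0) ^ (r - 1) * (2 ^ (r - 1) * (1 + D * K)), fun w => ?_⟩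
    calc ∑' x, G.locGrad w (n + 1) x ^ r
        ≤ ∑' x, (D : ℝ≥0∞) ^ (r - 1) * ((2 : ℝ≥0∞) ^ (r - 1) *
            (∑ y ∈ G.nbr x, ENNReal.ofReal |w y - w x| ^ r
              + ∑ y ∈ G.nbr x, G.locGrad w n y ^ r)) := by
          refine ENNReal.tsum_le_tsum fun x => ?_
          refine (ENNReal.rpow_sum_le_const_mul_sum_rpow _ _ hr).trans ?_
          gcongr
          · exact hD x
          · rw [← Finset.sum_add_distrib, Finset.mul_sum]
            exact Finset.sum_le_sum fun y _ => ENNReal.rpow_add_le_mul_rpow_add_rpow _ _ hr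
      _ = (D : ℝ≥0∞) ^ (r - 1) * ((2 : ℝ≥0∞) ^ (r - 1) *
            (G.energy r w + ∑' x, ∑ y ∈ G.nbr x, G.locGrad w n y ^ r)) := by
          rw [ENNReal.tsum_mul_left, ENNReal.tsum_mul_left, ENNReal.tsum_add]
          rfl
      _ ≤ (D : ℝ≥0∞) ^ (r - 1) * ((2 : ℝ≥0∞) ^ (r - 1) *
            (G.energy r w + D * (K * G.energy r w))) := by
          gcongr
          exact (tsum_sum_nbr_le hD _).trans (by gcongr; exact hK w)
      _ = _ := by
          rw [ENNReal.coe_mul, ENNReal.coe_mul, ENNReal.coe_rpow_of_nonneg _ hr1,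
            ENNReal.coe_rpow_of_nonneg _ hr1]
          push_cast
          ring

/-- Functions of finite energy pull back along coarse Lipschitz maps with bounded fibres. -/
theorem exists_energy_comp_le {Y : Type*} {H : LFGraph Y} {DG DH : ℕ} (hDG : G.BddVal DG)
    (hDH : H.BddVal DH) (hH : H.Conn) {F : X → Y} {N R : ℕ} (hF : FibreBound F N)
    (hR : ∀ x, ∀ x' ∈ G.nbr x, H.gdist (F x) (F x') ≤ R) {r : ℝ} (hr : 1 ≤ r) :
    ∃ K : ℝ≥0, ∀ w : Y → ℝ, G.energy r (fun x => w (F x)) ≤ K * H.energy r w := by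
  obtain ⟨K, hK⟩ := exists_tsum_locGrad_rpow_le hDH hr R
  refine ⟨DG * N * K, fun w => ?_⟩
  calc G.energy r (fun x => w (F x)) ≤ ∑' x, DG * H.locGrad w R (F x) ^ r := by
        refine ENNReal.tsum_le_tsum fun x => ?_
        calc ∑ x' ∈ G.nbr x, ENNReal.ofReal |w (F x') - w (F x)| ^ r
            ≤ ∑ _x' ∈ G.nbr x, H.locGrad w R (F x) ^ r := by
              gcongr with x' hx'
              exact hH.ofReal_abs_sub_le_locGrad w (hR x x' hx')
          _ = (G.nbr x).card * H.locGrad w R (F x) ^ r := by simp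
          _ ≤ DG * H.locGrad w R (F x) ^ r := by gcongr; exact hDG x
    _ = DG * ∑' x, H.locGrad w R (F x) ^ r := ENNReal.tsum_mul_left
    _ ≤ DG * (N * (K * H.energy r w)) := by
        gcongr
        exact (hF.tsum_comp_le fun y => H.locGrad w R y ^ r).trans (by gcongr; exact hK w)
    _ = _ := by push_cast; ring

theorem summable_iff_tsum_ofReal_ne_top {ι : Type*} {f : ι → ℝ} (hf : ∀ i, 0 ≤ f i) :
    Summable f ↔ ∑' i, ENNReal.ofReal (f i) ≠ ⊤ := by
  refine ⟨fun h => h.tsum_ofReal_ne_top, fun h => ?_⟩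
  simpa [ENNReal.toReal_ofReal, hf] using ENNReal.summable_toReal h

theorem memDp_iff_energy_ne_top {p : ℝ} (hp : 0 ≤ p) {w : X → ℝ} :
    G.MemDp p w ↔ G.energy p w ≠ ⊤ := by
  classical
  have h : G.energy p w = ∑' e : G.Edge, ENNReal.ofReal (|G.grad w e| ^ p) := by
    simp_rw [← ENNReal.ofReal_rpow_of_nonneg (abs_nonneg _) hp]
    refine Eq.trans ?_ (tsum_subtype {e : X × X | e.2 ∈ G.nbr e.1}
      (fun e => ENNReal.ofReal |w e.2 - w e.1| ^ p)).symm
    rw [ENNReal.tsum_prod']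
    refine tsum_congr fun x => ?_
    rw [tsum_eq_sum (s := G.nbr x) fun y hy => Set.indicator_of_notMem (by simpa using hy) _]
    exact Finset.sum_congr rfl fun y hy => by simp [Set.indicator, hy]
  rw [h, ← summable_iff_tsum_ofReal_ne_top fun e => Real.rpow_nonneg (abs_nonneg _) _]
  rfl

end Energy

end LFGraph

namespace LFGraph

section Isoperimetry

variable {X : Type*} {G : LFGraph X}

open Classical in
theorem bdry_eq_tsum (G : LFGraph X) (A : Finset X) :
    (G.bdry A : ℝ≥0∞) = ∑' x, ∑ y ∈ G.nbr x, if x ∈ A ∧ y ∉ A then 1 else 0 := by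
  rw [tsum_eq_sum (s := A) fun x hx => Finset.sum_eq_zero fun y _ => if_neg fun h => hx h.1, bdry]
  push_cast
  refine Finset.sum_congr rfl fun x hx => ?_
  simp [hx, Finset.card_filter, -Finset.sum_boole]

open Classical in
theorem energy_one_indicator (G : LFGraph X) (A : Finset X) :
    G.energy 1 (fun x => if x ∈ A then 1 else 0) = 2 * G.bdry A := by
  have h : ∑' x, ∑ y ∈ G.nbr x, (if y ∈ A ∧ x ∉ A then (1 : ℝ≥0∞) else 0) = G.bdry A := by
    rw [bdry_eq_tsum, G.tsum_sum_nbr_comm fun x y => if y ∈ A ∧ x ∉ A then (1 : ℝ≥0∞) else 0]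
  rw [two_mul]
  nth_rewrite 1 [bdry_eq_tsum]
  rw [← h, ← ENNReal.tsum_add]
  refine tsum_congr fun x => ?_
  rw [← Finset.sum_add_distrib]
  refine Finset.sum_congr rfl fun y _ => ?_
  by_cases hx : x ∈ A <;> by_cases hy : y ∈ A <;> simp [hx, hy]

/-- The isoperimetric profile `IS_d` is inherited along coarse equivalences. -/
theorem ISdim.of_coarse {Y : Type*} {H : LFGraph Y} {d : ℝ} (hd : 1 < d) (hIS : G.ISdim d)
    {DG DH : ℕ} (hDG : G.BddVal DG) (hDH : H.BddVal DH) (hH : H.Conn) {F : X → Y} {F' : Y → X}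
    {N N' R R' : ℕ} (hF : FibreBound F N) (hF' : FibreBound F' N')
    (hR : ∀ x, ∀ x' ∈ G.nbr x, H.gdist (F x) (F x') ≤ R)
    (hR' : ∀ y, H.gdist y (F (F' y)) ≤ R') : H.ISdim d := by
  classical
  obtain ⟨κ, hκ, hiso⟩ := hIS
  obtain ⟨K, hK⟩ := exists_energy_comp_le hDG hDH hH hF hR le_rfl
  obtain ⟨L, hL⟩ := exists_tsum_locGrad_rpow_le hDH le_rfl R'
  set θ := 1 - 1 / d with hθ
  have hd' : 1 / d < 1 := by rw [div_lt_one] <;> linarith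
  have hd0 : 0 < 1 / d := by positivity
  have hθ0 : 0 < θ := by linarith
  have hθ1 : θ ≤ 1 := by linarith
  refine ⟨(N' : ℝ) ^ θ * (κ * K) + (2 * L : ℝ) ^ θ + 1, by positivity, fun A _ => ?_⟩
  set B : Finset X := (hF.finite_preimage A.finite_toSet).toFinset with hB
  have memB : ∀ x, x ∈ B ↔ F x ∈ A := fun x => by simp [hB]
  have hbdB : (G.bdry B : ℝ) ≤ K * H.bdry A := by
    have h := hK fun y => if y ∈ A then 1 else 0
    simp_rw [← memB] at h
    rw [energy_one_indicator, energy_one_indicator, mul_left_comm,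
      ENNReal.mul_le_mul_iff_right (by simp) (by simp)] at h
    exact_mod_cast h
  have hcardB : (B.card : ℝ) ^ θ ≤ κ * (K * H.bdry A) := by
    rcases B.eq_empty_or_nonempty with h0 | h0
    · rw [h0, Finset.card_empty, Nat.cast_zero, Real.zero_rpow hθ0.ne']
      positivity
    · exact (hiso B h0).trans (by gcongr)
  have hnear : ((A.filter fun y => F (F' y) ∈ A).card : ℝ) ≤ N' * B.card := by
    have h1 : (A.filter fun y => F (F' y) ∈ A).card
        ≤ N' * ((A.filter fun y => F (F' y) ∈ A).image F').card := by
      refine Finset.card_le_mul_card_image _ _ fun x _ => ?_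
      obtain ⟨s, hs, hs'⟩ := hF' x
      exact (Finset.card_le_card fun y hy => hs' y (Finset.mem_filter.1 hy).2).trans hs
    have h2 : ((A.filter fun y => F (F' y) ∈ A).image F').card ≤ B.card := by
      refine Finset.card_le_card fun x hx => ?_
      obtain ⟨y, hy, rfl⟩ := Finset.mem_image.1 hx
      exact (memB _).2 (Finset.mem_filter.1 hy).2
    exact_mod_cast h1.trans (Nat.mul_le_mul_left _ h2)
  have hfar : ((A.filter fun y => F (F' y) ∉ A).card : ℝ) ≤ 2 * L * H.bdry A := by
    have h : ((A.filter fun y => F (F' y) ∉ A).card : ℝ≥0∞) ≤ L * (2 * H.bdry A) := by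
      rw [← energy_one_indicator]
      refine le_trans ?_ (hL _)
      refine le_trans ?_ (ENNReal.sum_le_tsum (A.filter fun y => F (F' y) ∉ A))
      rw [← nsmul_one]
      refine Finset.card_nsmul_le_sum _ _ _ fun y hy => ?_
      rw [Finset.mem_filter] at hy
      have := hH.ofReal_abs_sub_le_locGrad (fun y => if y ∈ A then (1 : ℝ) else 0) (hR' y)
      simpa [hy.1, hy.2] using this
    have h' : ((A.filter fun y => F (F' y) ∉ A).card : ℝ) ≤ L * (2 * H.bdry A) := by
      exact_mod_cast h
    linarith
  have hA : (A.card : ℝ) ≤ N' * B.card + 2 * L * H.bdry A := by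
    rw [← Finset.card_filter_add_card_filter_not (s := A) (fun y => F (F' y) ∈ A)]
    push_cast
    exact add_le_add hnear hfar
  have hβ : (H.bdry A : ℝ) ^ θ ≤ H.bdry A := by
    rcases Nat.eq_zero_or_pos (H.bdry A) with h0 | h0
    · simp [h0, hθ0.ne']
    · exact Real.rpow_le_self_of_one_le (by exact_mod_cast h0) hθ1
  calc (A.card : ℝ) ^ θ ≤ (N' * B.card + 2 * L * H.bdry A) ^ θ := by gcongr
    _ ≤ (N' * B.card : ℝ) ^ θ + (2 * L * H.bdry A) ^ θ :=
        Real.rpow_add_le_add_rpow (by positivity) (by positivity) hθ0.le hθ1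
    _ = (N' : ℝ) ^ θ * (B.card : ℝ) ^ θ + (2 * L : ℝ) ^ θ * (H.bdry A : ℝ) ^ θ := by
        rw [Real.mul_rpow (by positivity) (by positivity),
          Real.mul_rpow (by positivity) (by positivity)]
    _ ≤ (N' : ℝ) ^ θ * (κ * (K * H.bdry A)) + (2 * L : ℝ) ^ θ * H.bdry A := by gcongr
    _ ≤ _ := by
        have : (0 : ℝ) ≤ H.bdry A := by positivity
        linarith

/-- The `ℓ¹`-Sobolev inequality for finitely supported functions, from an isoperimetric
inequality. -/
theorem sobolev_of_isoperimetric {σ κ : ℝ} (hσ : 1 ≤ σ)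
    (hiso : ∀ A : Finset X, A.Nonempty → (A.card : ℝ) ^ (1 / σ) ≤ κ * G.bdry A) (A : Finset X) :
    ∀ w : X → ℝ, (∀ x, 0 ≤ w x) → (∀ x ∉ A, w x = 0) →
      (∑ x ∈ A, w x ^ σ) ^ (1 / σ) ≤ κ * ∑ x ∈ A, ∑ y ∈ G.nbr x, max (w x - w y) 0 := by
  classical
  have hσ0 : 0 < σ := by linarith
  induction A using Finset.strongInduction with
  | H A ih =>
  intro w hw hwA
  rcases A.eq_empty_or_nonempty with rfl | hA
  · simp [hσ0.ne']
  obtain ⟨x₀, hx₀, hmin⟩ := A.exists_min_image w hA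
  set m := w x₀ with hm
  have hm0 : 0 ≤ m := hw x₀
  set w' : X → ℝ := fun x => if x ∈ A then w x - m else 0 with hw'
  have hw'0 : ∀ x, 0 ≤ w' x := fun x => by
    simp only [hw']
    split_ifs with h
    · linarith [hmin x h]
    · exact le_rfl
  have hκ : 0 ≤ κ := by
    by_contra! hneg
    have h1 := hiso A hA
    have h2 : 0 < (A.card : ℝ) ^ (1 / σ) :=
      Real.rpow_pos_of_pos (by exact_mod_cast hA.card_pos) _
    have h3 : κ * G.bdry A ≤ 0 := mul_nonpos_of_nonpos_of_nonneg hneg.le (by positivity)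
    linarith
  have hw'x₀ : w' x₀ = 0 := by simp [hw', hx₀, hm]
  have hrec : (∑ x ∈ A, w' x ^ σ) ^ (1 / σ)
      ≤ κ * ∑ x ∈ A, ∑ y ∈ G.nbr x, max (w' x - w' y) 0 := by
    have h := ih (A.erase x₀) (Finset.erase_ssubset hx₀) w' hw'0 fun x hx => by
      by_cases hxA : x ∈ A
      · have : x = x₀ := by
          by_contra hne
          exact hx (Finset.mem_erase.2 ⟨hne, hxA⟩)
        rw [this, hw'x₀]
      · simp [hw', hxA]
    rw [Finset.sum_erase A (by rw [hw'x₀, Real.zero_rpow hσ0.ne'])] at h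
    refine h.trans ?_
    gcongr
    exact Finset.erase_subset _ _
  have hsplit : ∀ x ∈ A, w x = m + w' x := fun x hx => by simp [hw', hx]
  have hgrad : ∑ x ∈ A, ∑ y ∈ G.nbr x, max (w x - w y) 0
      = m * G.bdry A + ∑ x ∈ A, ∑ y ∈ G.nbr x, max (w' x - w' y) 0 := by
    rw [bdry, Nat.cast_sum, Finset.mul_sum, ← Finset.sum_add_distrib]
    refine Finset.sum_congr rfl fun x hx => ?_
    rw [Finset.card_filter, Nat.cast_sum, Finset.mul_sum, ← Finset.sum_add_distrib]
    refine Finset.sum_congr rfl fun y _ => ?_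
    by_cases hy : y ∈ A
    · rw [hsplit x hx, hsplit y hy]
      simp [hy]
    · have h1 : w' y = 0 := by simp [hw', hy]
      rw [hwA y hy, h1, sub_zero, sub_zero, max_eq_left (hw x), max_eq_left (hw'0 x)]
      simpa [hy] using hsplit x hx
  calc (∑ x ∈ A, w x ^ σ) ^ (1 / σ) = (∑ x ∈ A, (m + w' x) ^ σ) ^ (1 / σ) := by
        rw [Finset.sum_congr rfl fun x hx => by rw [hsplit x hx]]
    _ ≤ (∑ _x ∈ A, m ^ σ) ^ (1 / σ) + (∑ x ∈ A, w' x ^ σ) ^ (1 / σ) :=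
        Real.Lp_add_le_of_nonneg A hσ (fun _ _ => hm0) fun x _ => hw'0 x
    _ = (A.card : ℝ) ^ (1 / σ) * m + (∑ x ∈ A, w' x ^ σ) ^ (1 / σ) := by
        rw [Finset.sum_const, nsmul_eq_mul, Real.mul_rpow (Nat.cast_nonneg _) (Real.rpow_nonneg hm0 _),
          ← Real.rpow_mul hm0, mul_one_div_cancel hσ0.ne', Real.rpow_one]
    _ ≤ κ * G.bdry A * m + κ * ∑ x ∈ A, ∑ y ∈ G.nbr x, max (w' x - w' y) 0 := by
        gcongr
        exact hiso A hA
    _ = κ * ∑ x ∈ A, ∑ y ∈ G.nbr x, max (w x - w y) 0 := by rw [hgrad]; ring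

end Isoperimetry

end LFGraph

theorem rpow_sub_rpow_le_mul {γ a b : ℝ} (hγ : 1 ≤ γ) (ha : 0 ≤ a) (hb : 0 ≤ b) :
    max (a ^ γ - b ^ γ) 0 ≤ γ * (a ^ (γ - 1) * max (a - b) 0) := by
  have hγ0 : 0 < γ := by linarith
  rcases le_total a b with hab | hab
  · rw [max_eq_right (sub_nonpos.2 (Real.rpow_le_rpow ha hab hγ0.le)),
      max_eq_right (sub_nonpos.2 hab)]
    simp
  rw [max_eq_left (sub_nonneg.2 (Real.rpow_le_rpow hb hab hγ0.le)),
    max_eq_left (sub_nonneg.2 hab)]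
  rcases ha.eq_or_lt with rfl | ha
  · have : b = 0 := le_antisymm hab hb
    simp [this]
  have h := one_add_mul_self_le_rpow_one_add (s := b / a - 1) (by
    have : 0 ≤ b / a := by positivity
    linarith) hγ
  rw [add_sub_cancel, Real.div_rpow hb ha.le, le_div_iff₀ (Real.rpow_pos_of_pos ha _)] at h
  have h1 : a ^ γ = a ^ (γ - 1) * a := by
    rw [← Real.rpow_add_one ha.ne', sub_add_cancel]
  have h2 : (1 + γ * (b / a - 1)) * a ^ γ = a ^ γ - γ * (a ^ (γ - 1) * (a - b)) := by
    rw [h1]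
    field_simp
    ring
  linarith

theorem sq_abs_pow_sub_abs_pow_le (j : ℕ) (a b : ℝ) :
    (|a| ^ (j + 1) - |b| ^ (j + 1)) ^ 2
      ≤ (j + 1) * ((a - b) * (a ^ (2 * j + 1) - b ^ (2 * j + 1))) := by
  have nonneg_case : ∀ a b : ℝ, 0 ≤ b → b ≤ a → (a ^ (j + 1) - b ^ (j + 1)) ^ 2
      ≤ (j + 1) * ((a - b) * (a ^ (2 * j + 1) - b ^ (2 * j + 1))) := fun a b hb hab => by
    have ha : 0 ≤ a := hb.trans hab
    have h1 : a ^ (j + 1) - b ^ (j + 1) ≤ (j + 1) * (a ^ j * (a - b)) := by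
      have h := rpow_sub_rpow_le_mul (γ := (j + 1 : ℕ)) (by simp) ha hb
      rw [Real.rpow_natCast, Real.rpow_natCast, max_eq_left (sub_nonneg.2 hab)] at h
      have h' := (le_max_left _ _).trans h
      push_cast at h'
      rwa [add_sub_cancel_right, Real.rpow_natCast] at h'
    have h2 : a ^ j * (a ^ (j + 1) - b ^ (j + 1)) ≤ a ^ (2 * j + 1) - b ^ (2 * j + 1) := by
      have h3 : b ^ j * b ^ (j + 1) ≤ a ^ j * b ^ (j + 1) := by gcongr
      have h4 : ∀ x : ℝ, x ^ (2 * j + 1) = x ^ j * x ^ (j + 1) := fun x => by ring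
      rw [h4, h4]
      linarith
    have h0 : 0 ≤ a ^ (j + 1) - b ^ (j + 1) := sub_nonneg.2 (by gcongr)
    calc (a ^ (j + 1) - b ^ (j + 1)) ^ 2
        = (a ^ (j + 1) - b ^ (j + 1)) * (a ^ (j + 1) - b ^ (j + 1)) := sq _
      _ ≤ (j + 1) * (a ^ j * (a - b)) * (a ^ (j + 1) - b ^ (j + 1)) := by gcongr
      _ = (j + 1) * ((a - b) * (a ^ j * (a ^ (j + 1) - b ^ (j + 1)))) := by ring
      _ ≤ _ := by
        have : 0 ≤ a - b := sub_nonneg.2 hab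
        gcongr
  have opposite_case : ∀ a b : ℝ, 0 ≤ a → 0 ≤ b → (a ^ (j + 1) - b ^ (j + 1)) ^ 2
      ≤ (j + 1) * ((a + b) * (a ^ (2 * j + 1) + b ^ (2 * j + 1))) := fun a b ha hb => by
    have h1 : (a ^ (j + 1) - b ^ (j + 1)) ^ 2 ≤ (a + b) * (a ^ (2 * j + 1) + b ^ (2 * j + 1)) := by
      have e : (a + b) * (a ^ (2 * j + 1) + b ^ (2 * j + 1)) - (a ^ (j + 1) - b ^ (j + 1)) ^ 2
          = a * b ^ (2 * j + 1) + b * a ^ (2 * j + 1) + 2 * (a ^ (j + 1) * b ^ (j + 1)) := by ring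
      have : 0 ≤ a * b ^ (2 * j + 1) + b * a ^ (2 * j + 1) + 2 * (a ^ (j + 1) * b ^ (j + 1)) := by
        positivity
      linarith
    refine h1.trans (le_mul_of_one_le_left (by positivity) ?_)
    have : (0 : ℝ) ≤ j := by positivity
    linarith
  have odd_pow : ∀ x : ℝ, (-x) ^ (2 * j + 1) = -x ^ (2 * j + 1) := fun x =>
    Odd.neg_pow ⟨j, rfl⟩ x
  rcases le_total 0 a with ha | ha <;> rcases le_total 0 b with hb | hb
  · rw [abs_of_nonneg ha, abs_of_nonneg hb]
    rcases le_total b a with hab | hab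
    · exact nonneg_case a b hb hab
    · have h := nonneg_case b a ha hab
      linarith
  · rw [abs_of_nonneg ha, abs_of_nonpos hb]
    have h := opposite_case a (-b) ha (by linarith)
    rw [odd_pow] at h
    linarith
  · rw [abs_of_nonpos ha, abs_of_nonneg hb]
    have h := opposite_case (-a) b (by linarith) hb
    rw [odd_pow] at h
    linarith
  · rw [abs_of_nonpos ha, abs_of_nonpos hb]
    rcases le_total b a with hab | hab
    · have h := nonneg_case (-b) (-a) (by linarith) (by linarith)
      rw [odd_pow, odd_pow] at h
      linarith
    · have h := nonneg_case (-a) (-b) (by linarith) (by linarith)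
      rw [odd_pow, odd_pow] at h
      linarith

namespace LFGraph

section Dirichlet

variable {X : Type*} {G : LFGraph X}

/-- The combinatorial Laplacian. -/
def lap (G : LFGraph X) (u : X → ℝ) (x : X) : ℝ := ∑ y ∈ G.nbr x, (u x - u y)

/-- The `ℓ²`-Sobolev inequality for finitely supported functions. -/
theorem ISdim.sobolev_two {d : ℝ} (hd : 2 < d) (hIS : G.ISdim d) {D : ℕ} (hD : G.BddVal D) :
    ∃ K : ℝ, 0 ≤ K ∧ ∀ (A : Finset X) (v : X → ℝ), (∀ x, 0 ≤ v x) → (∀ x ∉ A, v x = 0) →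
      (∑ x ∈ A, v x ^ (2 * d / (d - 2))) ^ ((d - 2) / d)
        ≤ K * ∑ x ∈ A, ∑ y ∈ G.nbr x, max (v x - v y) 0 ^ 2 := by
  obtain ⟨κ, hκ, hiso⟩ := hIS
  have hd0 : 0 < d := by linarith
  have hd1 : 0 < d - 1 := by linarith
  have hd2 : 0 < d - 2 := by linarith
  set γ := 2 * (d - 1) / (d - 2) with hγ
  set σ := d / (d - 1) with hσ
  have hσ1 : 1 ≤ σ := by rw [hσ, le_div_iff₀ hd1]; linarith
  have hγ1 : 1 ≤ γ := by rw [hγ, le_div_iff₀ hd2]; linarith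
  have hσinv : 1 / σ = 1 - 1 / d := by rw [hσ]; field_simp
  have hγσ : γ * σ = 2 * d / (d - 2) := by rw [hγ, hσ]; field_simp
  have hγ2 : (γ - 1) * 2 = 2 * d / (d - 2) := by rw [hγ]; field_simp; ring
  refine ⟨κ ^ 2 * γ ^ 2 * D, by positivity, fun A v hv hvA => ?_⟩
  set S := ∑ x ∈ A, v x ^ (2 * d / (d - 2)) with hS
  set t : X → ℝ := fun x => ∑ y ∈ G.nbr x, max (v x - v y) 0 with ht
  set T := ∑ x ∈ A, ∑ y ∈ G.nbr x, max (v x - v y) 0 ^ 2 with hT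
  have hT0 : 0 ≤ T := Finset.sum_nonneg fun x _ => Finset.sum_nonneg fun y _ => sq_nonneg _
  have hS0 : 0 ≤ S := Finset.sum_nonneg fun x _ => Real.rpow_nonneg (hv x) _
  have h1 : S ^ (1 - 1 / d) ≤ κ * (γ * ∑ x ∈ A, v x ^ (γ - 1) * t x) := by
    have h := sobolev_of_isoperimetric hσ1 (by rwa [hσinv]) A (fun x => v x ^ γ)
      (fun x => Real.rpow_nonneg (hv x) _)
      fun x hx => by simp only [hvA x hx]; exact Real.zero_rpow (by linarith)
    simp_rw [← Real.rpow_mul (hv _), hγσ, hσinv] at h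
    refine h.trans ?_
    gcongr
    rw [Finset.mul_sum]
    refine Finset.sum_le_sum fun x _ => ?_
    rw [ht, Finset.mul_sum, Finset.mul_sum]
    exact Finset.sum_le_sum fun y _ => rpow_sub_rpow_le_mul hγ1 (hv x) (hv y)
  have h2 : (∑ x ∈ A, v x ^ (γ - 1) * t x) ^ 2 ≤ S * (D * T) := by
    refine (Finset.sum_mul_sq_le_sq_mul_sq A _ _).trans ?_
    have e : ∑ x ∈ A, (v x ^ (γ - 1)) ^ 2 = S := Finset.sum_congr rfl fun x _ => by
      rw [← Real.rpow_natCast, ← Real.rpow_mul (hv x), Nat.cast_ofNat, hγ2]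
    rw [e]
    gcongr
    rw [hT, Finset.mul_sum]
    refine Finset.sum_le_sum fun x _ => ?_
    refine sq_sum_le_card_mul_sum_sq.trans ?_
    gcongr
    exact hD x
  have h3 : (S ^ (1 - 1 / d)) ^ 2 ≤ κ ^ 2 * γ ^ 2 * (S * (D * T)) :=
    calc (S ^ (1 - 1 / d)) ^ 2 ≤ (κ * (γ * ∑ x ∈ A, v x ^ (γ - 1) * t x)) ^ 2 :=
          pow_le_pow_left₀ (Real.rpow_nonneg hS0 _) h1 2
      _ = κ ^ 2 * γ ^ 2 * (∑ x ∈ A, v x ^ (γ - 1) * t x) ^ 2 := by ring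
      _ ≤ _ := by gcongr
  rcases hS0.eq_or_lt with hS0 | hS0
  · rw [← hS0, Real.zero_rpow (by positivity)]
    positivity
  have h4 : (S ^ (1 - 1 / d)) ^ 2 = S * S ^ ((d - 2) / d) := by
    rw [← Real.rpow_natCast, ← Real.rpow_mul hS0.le, ← Real.rpow_one_add' hS0.le (by positivity)]
    congr 1
    push_cast
    field_simp
    ring
  rw [h4] at h3
  refine le_of_mul_le_mul_left (h3.trans_eq ?_) hS0
  ring

/-- Testing the Laplacian of a finitely supported function against one of its odd powers. -/
theorem sum_sq_le_sum_lap_mul_pow (j : ℕ) (A : Finset X) {u : X → ℝ} (hu : ∀ x ∉ A, u x = 0) :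
    ∑ x ∈ A, ∑ y ∈ G.nbr x, max (|u x| ^ (j + 1) - |u y| ^ (j + 1)) 0 ^ 2
      ≤ 2 * (j + 1) * ∑ x ∈ A, G.lap u x * u x ^ (2 * j + 1) := by
  classical
  set Φ : X → X → ℝ := fun x y => (u x - u y) * u x ^ (2 * j + 1) with hΦ
  have hmax : ∀ a : ℝ, max a 0 ^ 2 ≤ a ^ 2 := fun a => by
    rcases le_total a 0 with h | h
    · rw [max_eq_right h, zero_pow two_ne_zero]
      exact sq_nonneg a
    · rw [max_eq_left h]
  have hj : (1 : ℝ) ≤ j + 1 := by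
    have : (0 : ℝ) ≤ j := by positivity
    linarith
  have hin : ∀ x, ∑ y ∈ G.nbr x, Φ x y = ∑ y ∈ A, (if y ∈ G.nbr x then Φ x y else 0)
      + ∑ y ∈ G.nbr x \ A, Φ x y := fun x => by
    rw [← Finset.sum_filter, ← Finset.sum_inter_add_sum_sdiff (G.nbr x) A]
    congr 2
    ext y
    simp [and_comm]
  have hin' : ∀ x, ∑ y ∈ G.nbr x, max (|u x| ^ (j + 1) - |u y| ^ (j + 1)) 0 ^ 2
      = ∑ y ∈ A, (if y ∈ G.nbr x then max (|u x| ^ (j + 1) - |u y| ^ (j + 1)) 0 ^ 2 else 0)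
      + ∑ y ∈ G.nbr x \ A, max (|u x| ^ (j + 1) - |u y| ^ (j + 1)) 0 ^ 2 := fun x => by
    rw [← Finset.sum_filter, ← Finset.sum_inter_add_sum_sdiff (G.nbr x) A]
    congr 2
    ext y
    simp [and_comm]
  have hswap : ∑ x ∈ A, ∑ y ∈ A, (if y ∈ G.nbr x then Φ x y else 0)
      = ∑ x ∈ A, ∑ y ∈ A, (if y ∈ G.nbr x then Φ y x else 0) := by
    rw [Finset.sum_comm]
    simp_rw [fun x y => G.symm x y]
  have hsym : 2 * ∑ x ∈ A, ∑ y ∈ A, (if y ∈ G.nbr x then Φ x y else 0)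
      = ∑ x ∈ A, ∑ y ∈ A, (if y ∈ G.nbr x then Φ x y + Φ y x else 0) := by
    rw [two_mul]
    nth_rewrite 2 [hswap]
    rw [← Finset.sum_add_distrib]
    refine Finset.sum_congr rfl fun x _ => ?_
    rw [← Finset.sum_add_distrib]
    exact Finset.sum_congr rfl fun y _ => by split_ifs <;> simp
  have hlap : ∀ x, G.lap u x * u x ^ (2 * j + 1) = ∑ y ∈ G.nbr x, Φ x y := fun x => by
    rw [lap, Finset.sum_mul]
  simp_rw [hlap, hin, hin', Finset.sum_add_distrib]
  rw [mul_add, mul_right_comm, hsym, mul_comm _ (j + 1 : ℝ), Finset.mul_sum, Finset.mul_sum]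
  refine add_le_add (Finset.sum_le_sum fun x _ => ?_) (Finset.sum_le_sum fun x _ => ?_)
  · rw [Finset.mul_sum]
    refine Finset.sum_le_sum fun y _ => ?_
    split_ifs
    · refine (hmax _).trans ((sq_abs_pow_sub_abs_pow_le j (u x) (u y)).trans_eq ?_)
      simp only [hΦ]
      ring
    · simp
  · rw [Finset.mul_sum]
    refine Finset.sum_le_sum fun y hy => (hmax _).trans ?_
    have hpow : (0 : ℝ) ≤ u x ^ (2 * j + 2) := Even.pow_nonneg ⟨j + 1, by ring⟩ _
    have e1 : (|u x| ^ (j + 1) - |(0 : ℝ)| ^ (j + 1)) ^ 2 = u x ^ (2 * j + 2) := by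
      rw [abs_zero, zero_pow (by simp), sub_zero, ← pow_mul, ← Even.pow_abs ⟨j + 1, by ring⟩ (u x)]
      ring
    simp only [hΦ]
    rw [hu y (Finset.mem_sdiff.1 hy).2, e1]
    calc u x ^ (2 * j + 2) ≤ (2 * (j + 1)) * u x ^ (2 * j + 2) :=
          le_mul_of_one_le_left hpow (by linarith)
      _ = _ := by ring

/-- An a priori estimate for the Dirichlet problem on finite sets, uniform in the set. -/
theorem ISdim.sum_rpow_le {d : ℝ} (hd : 2 < d) (hIS : G.ISdim d) {D : ℕ} (hD : G.BddVal D)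
    (j : ℕ) {α β : ℝ} (hα : α = (d - 2) / d) (hβ : β = α * ((2 * j + 1) / (2 * j + 2))) :
    ∃ K : ℝ, 0 ≤ K ∧ ∀ (A : Finset X) (u : X → ℝ), (∀ x ∉ A, u x = 0) →
      (∑ x ∈ A, |u x| ^ ((2 * j + 2) / α)) ^ (α - β)
        ≤ K * (∑ x ∈ A, |G.lap u x| ^ (1 / (1 - β))) ^ (1 - β) := by
  obtain ⟨K, hK, hsob⟩ := hIS.sobolev_two hd hD
  have hd0 : 0 < d := by linarith
  have hα0 : 0 < α := by rw [hα]; exact div_pos (by linarith) hd0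
  have hα1 : α < 1 := by rw [hα, div_lt_one hd0]; linarith
  have hj : (0 : ℝ) ≤ j := by positivity
  have hβ0 : 0 < β := by rw [hβ]; positivity
  have hβα : β < α := by
    rw [hβ]
    refine mul_lt_of_lt_one_right hα0 ?_
    rw [div_lt_one (by positivity)]
    linarith
  have h1β : 0 < 1 - β := by linarith
  refine ⟨K * (2 * (j + 1)), by positivity, fun A u hu => ?_⟩
  set S := ∑ x ∈ A, |u x| ^ ((2 * j + 2) / α) with hS
  have hS0 : 0 ≤ S := Finset.sum_nonneg fun x _ => Real.rpow_nonneg (abs_nonneg _) _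
  set Λ := (∑ x ∈ A, |G.lap u x| ^ (1 / (1 - β))) ^ (1 - β) with hΛ
  have hΛ0 : 0 ≤ Λ := Real.rpow_nonneg
    (Finset.sum_nonneg fun x _ => Real.rpow_nonneg (abs_nonneg _) _) _
  have h1 : S ^ α ≤ K * (2 * (j + 1) * ∑ x ∈ A, G.lap u x * u x ^ (2 * j + 1)) := by
    have h := hsob A (fun x => |u x| ^ (j + 1)) (fun x => by positivity)
      fun x hx => by simp [hu x hx]
    have e : ∀ x, (|u x| ^ (j + 1)) ^ (2 * d / (d - 2)) = |u x| ^ ((2 * j + 2) / α) := fun x => by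
      rw [← Real.rpow_natCast, ← Real.rpow_mul (abs_nonneg _), hα]
      congr 1
      have : d - 2 ≠ 0 := by linarith
      push_cast
      field_simp
    simp_rw [e, ← hα] at h
    exact h.trans (mul_le_mul_of_nonneg_left (sum_sq_le_sum_lap_mul_pow j A hu) hK)
  have h2 : ∑ x ∈ A, G.lap u x * u x ^ (2 * j + 1) ≤ Λ * S ^ β := by
    have hconj : (1 / (1 - β)).HolderConjugate (1 / β) := by
      rw [Real.holderConjugate_iff]
      refine ⟨by rw [lt_div_iff₀ h1β]; linarith, ?_⟩
      simp
    calc ∑ x ∈ A, G.lap u x * u x ^ (2 * j + 1)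
        ≤ ∑ x ∈ A, |G.lap u x| * |u x| ^ (2 * j + 1) := Finset.sum_le_sum fun x _ => by
          rw [← abs_pow, ← abs_mul]
          exact le_abs_self _
      _ ≤ _ := Real.inner_le_Lp_mul_Lq_of_nonneg A hconj (fun _ _ => abs_nonneg _)
          fun _ _ => by positivity
      _ = Λ * S ^ β := by
          rw [one_div_one_div, one_div_one_div, hΛ, hS]
          congr 2
          refine Finset.sum_congr rfl fun x _ => ?_
          rw [← Real.rpow_natCast, ← Real.rpow_mul (abs_nonneg _), hβ]
          congr 1
          push_cast
          field_simp
  rcases hS0.eq_or_lt with hS0 | hS0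
  · rw [← hS0, Real.zero_rpow (by linarith)]
    positivity
  rw [Real.rpow_sub hS0, div_le_iff₀ (Real.rpow_pos_of_pos hS0 _)]
  calc S ^ α ≤ K * (2 * (j + 1) * (Λ * S ^ β)) := h1.trans (by gcongr)
    _ = _ := by ring

end Dirichlet

end LFGraph

namespace LFGraph

section Poisson

variable {X : Type*} {G : LFGraph X}

/-- Solvability of the Dirichlet problem on a finite set, given uniqueness. -/
theorem exists_lap_eq_on (A : Finset X)
    (huniq : ∀ u : X → ℝ, (∀ x ∉ A, u x = 0) → (∀ x ∈ A, G.lap u x = 0) → ∀ x, u x = 0)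
    (φ : X → ℝ) : ∃ u : X → ℝ, (∀ x ∉ A, u x = 0) ∧ ∀ x ∈ A, G.lap u x = φ x := by
  classical
  let ext : (A → ℝ) → X → ℝ := fun v x => if h : x ∈ A then v ⟨x, h⟩ else 0
  have ext_of_notMem : ∀ v, ∀ x ∉ A, ext v x = 0 := fun v x hx => dif_neg hx
  let T : (A → ℝ) →ₗ[ℝ] (A → ℝ) :=
    { toFun := fun v a => G.lap (ext v) a
      map_add' := fun v w => by
        funext a
        simp only [lap, Pi.add_apply, ← Finset.sum_add_distrib]
        refine Finset.sum_congr rfl fun y _ => ?_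
        have e : ∀ x, ext (v + w) x = ext v x + ext w x := fun x => by
          simp only [ext]
          split_ifs <;> simp
        rw [e, e]
        ring
      map_smul' := fun c v => by
        funext a
        simp only [lap, Pi.smul_apply, smul_eq_mul, Finset.mul_sum, RingHom.id_apply]
        refine Finset.sum_congr rfl fun y _ => ?_
        have e : ∀ x, ext (c • v) x = c * ext v x := fun x => by
          simp only [ext]
          split_ifs <;> simp
        rw [e, e]
        ring }
  have hinj : Function.Injective T := by
    rw [injective_iff_map_eq_zero]
    intro v hv
    have h := huniq (ext v) (ext_of_notMem v) fun x hx => congrFun hv ⟨x, hx⟩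
    funext a
    simpa [ext] using h a
  obtain ⟨v, hv⟩ := LinearMap.injective_iff_surjective.1 hinj fun a => φ a
  exact ⟨ext v, ext_of_notMem v, fun x hx => congrFun hv ⟨x, hx⟩⟩

theorem _root_.lpMem.mono {ι : Type*} {p q : ℝ} (hp : 0 < p) (hpq : p ≤ q) {f : ι → ℝ}
    (hf : lpMem p f) : lpMem q f := by
  refine Summable.of_norm_bounded_eventually hf ?_
  have h := hf.tendsto_cofinite_zero.eventually (gt_mem_nhds one_pos)
  filter_upwards [h] with i hi
  have h1 : |f i| ≤ 1 := by
    by_contra! hgt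
    exact absurd hi (not_lt.2 (Real.one_le_rpow hgt.le hp.le))
  rw [Real.norm_of_nonneg (Real.rpow_nonneg (abs_nonneg _) _)]
  rcases (abs_nonneg (f i)).eq_or_lt with h0 | h0
  · rw [← h0, Real.zero_rpow hp.ne', Real.zero_rpow (hp.trans_le hpq).ne']
  · exact Real.rpow_le_rpow_of_exponent_ge h0 h1 hpq

theorem _root_.lpMem.finite_le_abs {ι : Type*} {p : ℝ} (hp : 0 < p) {f : ι → ℝ}
    (hf : lpMem p f) {ε : ℝ} (hε : 0 < ε) : {i | ε ≤ |f i|}.Finite := by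
  have h := hf.tendsto_cofinite_zero.eventually (gt_mem_nhds (Real.rpow_pos_of_pos hε p))
  refine (Filter.eventually_cofinite.1 h).subset fun i hi => not_lt.2 ?_
  exact Real.rpow_le_rpow hε.le hi hp.le

/-- On a graph with `IS_d`, the Poisson equation with right-hand side in `ℓ^p`, `p < d / 2`,
has a solution in some `ℓ^q` with `q` finite. -/
theorem ISdim.exists_lap_eq {d : ℝ} (hIS : G.ISdim d) {D : ℕ} (hD : G.BddVal D) {p : ℝ}
    (hp : 1 ≤ p) (hpd : p < d / 2) {φ : X → ℝ} (hφ : lpMem p φ) :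
    ∃ (q : ℝ) (u : X → ℝ), 0 < q ∧ lpMem q u ∧ ∀ x, G.lap u x = φ x := by
  classical
  have hp0 : 0 < p := by linarith
  have hd : 2 < d := by linarith
  have hd0 : 0 < d := by linarith
  set α := (d - 2) / d with hα
  have hα0 : 0 < α := div_pos (by linarith) hd0
  have hgap : 0 < 1 / p - 2 / d := by
    rw [sub_pos, div_lt_div_iff₀ hd0 hp0]
    linarith
  obtain ⟨j, hj⟩ := exists_nat_gt (α / (1 / p - 2 / d))
  have hj0 : (0 : ℝ) ≤ j := by positivity
  set β := α * ((2 * j + 1) / (2 * j + 2)) with hβ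
  have hαβ : α - β = α / (2 * j + 2) := by rw [hβ]; field_simp; ring
  have hαd : 1 - α = 2 / d := by rw [hα]; field_simp; ring
  have hpos : 0 < α - β := by rw [hαβ]; positivity
  have h1β : 0 < 1 - β := by
    have : 0 < 2 / d := by positivity
    linarith
  have hpβ : p ≤ 1 / (1 - β) := by
    rw [le_div_iff₀ h1β, ← le_div_iff₀' hp0]
    have : α / (2 * j + 2) ≤ 1 / p - 2 / d := by
      rw [div_le_iff₀ (by positivity)]
      rw [div_lt_iff₀ hgap] at hj
      nlinarith
    linarith
  obtain ⟨K, hK, hest⟩ := hIS.sum_rpow_le hd hD j hα hβ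
  set q := (2 * j + 2) / α with hq
  have hq0 : 0 < q := by positivity
  have hφ' : lpMem (1 / (1 - β)) φ := hφ.mono hp0 hpβ
  set M := (K * (∑' x, |φ x| ^ (1 / (1 - β))) ^ (1 - β)) ^ (α - β)⁻¹ with hM
  have solve : ∀ A : Finset X, ∃ u : X → ℝ, (∀ x ∉ A, u x = 0) ∧ ∀ x ∈ A, G.lap u x = φ x :=
    fun A => exists_lap_eq_on A (fun u hu hlap x => by
      by_cases hx : x ∈ A
      · have h := hest A u hu
        have e : ∑ x ∈ A, |G.lap u x| ^ (1 / (1 - β)) = 0 := Finset.sum_eq_zero fun x hx => by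
          rw [hlap x hx, abs_zero, Real.zero_rpow (by positivity)]
        rw [e, Real.zero_rpow h1β.ne', mul_zero] at h
        have hS0 : 0 ≤ ∑ x ∈ A, |u x| ^ q :=
          Finset.sum_nonneg fun x _ => Real.rpow_nonneg (abs_nonneg _) _
        have hS : ∑ x ∈ A, |u x| ^ q = 0 := by
          by_contra hne
          exact (Real.rpow_pos_of_pos (lt_of_le_of_ne hS0 (Ne.symm hne)) _).not_ge h
        have h0 := (Finset.sum_eq_zero_iff_of_nonneg
          fun x _ => Real.rpow_nonneg (abs_nonneg _) _).1 hS x hx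
        exact abs_eq_zero.1 ((Real.rpow_eq_zero (abs_nonneg _) hq0.ne').1 h0)
      · exact hu x hx) φ
  choose u huA hlap using solve
  have hbound : ∀ A F : Finset X, ∑ x ∈ F, |u A x| ^ q ≤ M := fun A F => by
    have h0 : ∀ B : Finset X, 0 ≤ ∑ x ∈ B, |u A x| ^ q := fun B =>
      Finset.sum_nonneg fun x _ => Real.rpow_nonneg (abs_nonneg _) _
    have h1 : ∑ x ∈ F, |u A x| ^ q ≤ ∑ x ∈ A, |u A x| ^ q := by
      have h2 : ∑ x ∈ A, |u A x| ^ q = ∑ x ∈ F ∪ A, |u A x| ^ q :=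
        Finset.sum_subset Finset.subset_union_right fun x _ hxA => by
          rw [huA A x hxA, abs_zero, Real.zero_rpow hq0.ne']
      rw [h2]
      exact Finset.sum_le_sum_of_subset_of_nonneg Finset.subset_union_left
        fun x _ _ => Real.rpow_nonneg (abs_nonneg _) _
    refine h1.trans ?_
    rw [hM, Real.le_rpow_inv_iff_of_pos (h0 A) (by positivity) hpos]
    refine (hest A (u A) (huA A)).trans ?_
    gcongr
    rw [Finset.sum_congr rfl fun x hx => by rw [hlap A x hx]]
    exact hφ'.sum_le_tsum A fun x _ => Real.rpow_nonneg (abs_nonneg _) _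
  have hM0 : 0 ≤ M := by simpa using hbound ∅ ∅
  have hpt : ∀ A x, |u A x| ≤ M ^ q⁻¹ := fun A x => by
    rw [Real.le_rpow_inv_iff_of_pos (abs_nonneg _) hM0 hq0]
    simpa using hbound A {x}
  let U : Ultrafilter (Finset X) := Ultrafilter.of atTop
  have hU : (U : Filter (Finset X)) ≤ atTop := Ultrafilter.of_le _
  have hlim : ∀ x, ∃ l, Tendsto (fun A => u A x) U (𝓝 l) := fun x => by
    obtain ⟨l, -, hl⟩ := (isCompact_Icc (a := -M ^ q⁻¹) (b := M ^ q⁻¹)).ultrafilter_le_nhds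
      (U.map fun A => u A x) (by
        rw [Filter.le_principal_iff]
        exact Filter.mem_map.2 (Filter.univ_mem' fun A => abs_le.1 (hpt A x)))
    exact ⟨l, hl⟩
  choose v hv using hlim
  refine ⟨q, v, hq0, ?_, fun x => ?_⟩
  · refine summable_of_sum_le (c := M) (fun x => Real.rpow_nonneg (abs_nonneg _) _) fun F => ?_
    refine le_of_tendsto (tendsto_finsetSum F fun x _ =>
      ((hv x).abs.rpow_const (Or.inr hq0.le))) (Filter.Eventually.of_forall fun A => hbound A F)
  · have h1 : Tendsto (fun A => G.lap (u A) x) U (𝓝 (G.lap v x)) :=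
      tendsto_finsetSum _ fun y _ => (hv x).sub (hv y)
    have h2 : Tendsto (fun A => G.lap (u A) x) U (𝓝 (φ x)) := by
      refine tendsto_const_nhds.congr' ?_
      filter_upwards [hU (Filter.eventually_ge_atTop ({x} : Finset X))] with A hA
      exact (hlap A x (hA (Finset.mem_singleton_self x))).symm
    exact tendsto_nhds_unique h1 h2

end Poisson

end LFGraph

/-- Truncation of a real number to the interval `[-r, r]`. -/
noncomputable def clamp (r t : ℝ) : ℝ := max (-r) (min t r)

theorem clamp_mono (r : ℝ) : Monotone (clamp r) := fun _ _ h =>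
  max_le_max le_rfl (min_le_min h le_rfl)

theorem clamp_sub_le (r : ℝ) {a b : ℝ} (h : b ≤ a) : clamp r a - clamp r b ≤ a - b := by
  unfold clamp
  grind

theorem abs_clamp_sub_le (r a b : ℝ) : |clamp r a - clamp r b| ≤ |a - b| := by
  rcases le_total b a with h | h
  · rw [abs_of_nonneg (sub_nonneg.2 (clamp_mono r h)), abs_of_nonneg (sub_nonneg.2 h)]
    exact clamp_sub_le r h
  · rw [abs_of_nonpos (sub_nonpos.2 (clamp_mono r h)), abs_of_nonpos (sub_nonpos.2 h)]
    linarith [clamp_sub_le r h]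

theorem abs_clamp_le_s6 {r : ℝ} (hr : 0 ≤ r) (t : ℝ) : |clamp r t| ≤ r :=
  abs_le.2 ⟨le_max_left _ _, max_le (by linarith) (min_le_right _ _)⟩

theorem clamp_of_abs_le {r t : ℝ} (h : |t| ≤ r) : clamp r t = t := by
  rw [abs_le] at h
  rw [clamp, min_eq_left h.2, max_eq_right h.1]

theorem abs_sub_clamp_add_clamp_sub_le (r s c a b : ℝ) :
    |(a - clamp r a + clamp s (clamp r a - c)) - (b - clamp r b + clamp s (clamp r b - c))|
      ≤ |a - b| := by
  have key : ∀ {a b : ℝ}, b ≤ a →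
      |(a - clamp r a + clamp s (clamp r a - c)) - (b - clamp r b + clamp s (clamp r b - c))|
        ≤ a - b := fun {a b} h => by
    have h1 := clamp_sub_le r h
    have h2 : clamp r b - c ≤ clamp r a - c := sub_le_sub_right (clamp_mono r h) c
    have h3 := clamp_sub_le s h2
    have h4 := clamp_mono s h2
    rw [abs_le]
    constructor <;> linarith
  rcases le_total b a with h | h
  · exact (key h).trans (le_abs_self _)
  · rw [abs_sub_comm, abs_sub_comm a b]
    exact (key h).trans (le_abs_self _)

namespace LFGraph

section Closure

variable {X : Type*} {G : LFGraph X}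

theorem MemDp.of_abs_sub_le {p : ℝ} (hp : 0 ≤ p) {g h : X → ℝ} (hg : G.MemDp p g)
    (hle : ∀ x y, |h y - h x| ≤ |g y - g x|) : G.MemDp p h :=
  Summable.of_nonneg_of_le (fun _ => Real.rpow_nonneg (abs_nonneg _) _)
    (fun e => Real.rpow_le_rpow (abs_nonneg _) (hle e.1.1 e.1.2) hp) hg

/-- If all truncations of `g ∈ D^p` are constant at infinity, then the class of `g` in reduced
cohomology is trivial. -/
theorem MemDp.inClos {p : ℝ} (hp : 0 < p) {g : X → ℝ} (hg : G.MemDp p g) (e0 : X)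
    (h : ∀ n : ℕ, ∃ c : ℝ, ∀ ε > 0, {x | ε ≤ |clamp n (g x) - c|}.Finite) :
    G.InClos p e0 g := by
  choose c hc using h
  set δ : ℕ → ℝ := fun n => 1 / ((n : ℝ) + 1) with hδ
  have hδ0 : ∀ n, 0 < δ n := fun n => by positivity
  have hδlim : Tendsto δ atTop (𝓝 0) := tendsto_one_div_add_atTop_nhds_zero_nat
  set f : ℕ → X → ℝ := fun n x =>
    clamp n (g x) - c n - clamp (δ n) (clamp n (g x) - c n) with hf
  have hlip : ∀ n x y, |(g y - (f n y + c n)) - (g x - (f n x + c n))| ≤ |g y - g x| :=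
    fun n x y => by
      refine le_of_eq_of_le ?_ (abs_sub_clamp_add_clamp_sub_le n (δ n) (c n) (g y) (g x))
      simp only [hf]
      congr 1
      ring
  have hsmall : ∀ x, ∀ᶠ n in atTop, |g x - (f n x + c n)| ≤ δ n := fun x => by
    obtain ⟨N, hN⟩ := exists_nat_ge |g x|
    filter_upwards [eventually_ge_atTop N] with n hn
    have hx : clamp n (g x) = g x := clamp_of_abs_le (hN.trans (by exact_mod_cast hn))
    have e : g x - (f n x + c n) = clamp (δ n) (g x - c n) := by
      simp only [hf, hx]
      ring
    rw [e]
    exact abs_clamp_le_s6 (hδ0 n).le _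
  have hpt : ∀ x, Tendsto (fun n => g x - (f n x + c n)) atTop (𝓝 0) := fun x =>
    squeeze_zero_norm' (hsmall x) hδlim
  have hgrad : Tendsto (fun n => G.gradNorm p fun x => g x - (f n x + c n)) atTop (𝓝 0) := by
    have h1 : Tendsto (fun n => ∑' e : G.Edge, |G.grad (fun x => g x - (f n x + c n)) e| ^ p)
        atTop (𝓝 (∑' _e : G.Edge, (0 : ℝ))) := by
      refine tendsto_tsum_of_dominated_convergence (bound := fun e => |G.grad g e| ^ p) hg
        (fun e => ?_) (Filter.Eventually.of_forall fun n e => ?_)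
      · have := (((hpt e.1.2).sub (hpt e.1.1)).abs.rpow_const (p := p) (Or.inr hp.le))
        simpa [grad, hp.ne'] using this
      · rw [Real.norm_of_nonneg (Real.rpow_nonneg (abs_nonneg _) _)]
        exact Real.rpow_le_rpow (abs_nonneg _) (hlip n _ _) hp.le
    rw [tsum_zero] at h1
    have h2 := h1.rpow_const (p := 1 / p) (Or.inr (by positivity))
    rwa [Real.zero_rpow (by positivity)] at h2
  have hdist : Tendsto (fun n => G.dpDist p e0 g fun x => f n x + c n) atTop (𝓝 0) := by
    simpa [dpDist] using hgrad.add (hpt e0).abs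
  intro ε hε
  obtain ⟨n, hn⟩ := (hdist.eventually (gt_mem_nhds hε)).exists
  refine ⟨f n, c n, ?_, hg.of_abs_sub_le hp.le (hlip n), hn⟩
  refine summable_of_hasFiniteSupport ((hc n (δ n) (hδ0 n)).subset fun x hx => ?_)
  by_contra hlt
  refine hx ?_
  have : f n x = 0 := by
    simp only [hf]
    rw [clamp_of_abs_le (not_le.1 hlt).le, sub_self]
  simp [this, hp.ne']

theorem MemDp.lpMem_lap {p : ℝ} (hp : 1 ≤ p) {D : ℕ} (hD : G.BddVal D) {w : X → ℝ}
    (hw : G.MemDp p w) : lpMem p (G.lap w) := by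
  have hp0 : 0 ≤ p := by linarith
  have hp1 : 0 ≤ p - 1 := by linarith
  rw [memDp_iff_energy_ne_top hp0] at hw
  unfold lpMem
  rw [summable_iff_tsum_ofReal_ne_top fun _ => Real.rpow_nonneg (abs_nonneg _) _]
  have hle : ∑' x, ENNReal.ofReal (|G.lap w x| ^ p) ≤ (D : ℝ≥0∞) ^ (p - 1) * G.energy p w := by
    rw [energy, ← ENNReal.tsum_mul_left]
    refine ENNReal.tsum_le_tsum fun x => ?_
    rw [← ENNReal.ofReal_rpow_of_nonneg (abs_nonneg _) hp0]
    have h1 : ENNReal.ofReal |G.lap w x| ≤ ∑ y ∈ G.nbr x, ENNReal.ofReal |w y - w x| := by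
      rw [← ENNReal.ofReal_sum_of_nonneg fun _ _ => abs_nonneg _]
      refine ENNReal.ofReal_le_ofReal ((Finset.abs_sum_le_sum_abs _ _).trans_eq ?_)
      exact Finset.sum_congr rfl fun y _ => abs_sub_comm _ _
    refine (ENNReal.rpow_le_rpow h1 hp0).trans
      ((ENNReal.rpow_sum_le_const_mul_sum_rpow _ _ hp).trans ?_)
    gcongr
    exact hD x
  exact ne_top_of_le_ne_top
    (ENNReal.mul_ne_top (ENNReal.rpow_ne_top_of_nonneg hp1 (ENNReal.natCast_ne_top _)) hw) hle

/-- A function in `D^p` changes little under bounded displacements, outside a finite set. -/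
theorem MemDp.finite_le_abs_sub {p : ℝ} (hp : 1 ≤ p) (hG : G.Conn) {D : ℕ} (hD : G.BddVal D)
    {w : X → ℝ} (hw : G.MemDp p w) {τ : X → X} {R : ℕ} (hτ : ∀ x, G.gdist x (τ x) ≤ R) {ε : ℝ}
    (hε : 0 < ε) : {x | ε ≤ |w (τ x) - w x|}.Finite := by
  have hp0 : 0 < p := by linarith
  obtain ⟨K, hK⟩ := exists_tsum_locGrad_rpow_le hD hp R
  rw [memDp_iff_energy_ne_top hp0.le] at hw
  have hfin : ∑' x, G.locGrad w R x ^ p ≠ ⊤ :=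
    ne_top_of_le_ne_top (ENNReal.mul_ne_top ENNReal.coe_ne_top hw) (hK w)
  refine (ENNReal.finite_const_le_of_tsum_ne_top hfin
    (ε := ENNReal.ofReal ε ^ p) ?_).subset fun x hx => ?_
  · exact (ENNReal.rpow_pos (ENNReal.ofReal_pos.2 hε) ENNReal.ofReal_ne_top).ne'
  · exact ENNReal.rpow_le_rpow ((ENNReal.ofReal_le_ofReal hx).trans
      (hG.ofReal_abs_sub_le_locGrad w (hτ x))) hp0.le

theorem harmonic_sub_of_lap_eq {b u : X → ℝ} (h : ∀ x, G.lap u x = G.lap b x) :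
    G.Harmonic fun x => b x - u x := fun x => by
  have hx := h x
  simp only [lap, Finset.sum_sub_distrib, Finset.sum_const, nsmul_eq_mul] at hx
  rw [Finset.sum_sub_distrib]
  linarith

theorem _root_.lpMem.boundedFun {p : ℝ} (hp : 0 < p) {u : X → ℝ} (hu : lpMem p u) :
    BoundedFun u := by
  obtain ⟨M, hM⟩ := ((hu.finite_le_abs hp one_pos).image fun x => |u x|).bddAbove
  refine ⟨max M 1, fun x => ?_⟩
  by_cases hx : 1 ≤ |u x|
  · exact le_max_of_le_left (hM ⟨x, hx, rfl⟩)
  · exact le_max_of_le_right (not_le.1 hx).le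

end Closure

/-- A quasi-isometry has a coarse inverse; both maps are coarsely Lipschitz and have bounded
fibres. -/
theorem QI.exists_inverse {X Y : Type*} {G : LFGraph X} {H : LFGraph Y} {DG DH : ℕ}
    (hDG : G.BddVal DG) (hDH : H.BddVal DH) {f : X → Y} (h : QI G H f) :
    ∃ (f' : Y → X) (N N' R : ℕ), FibreBound f N ∧ FibreBound f' N' ∧
      (∀ x, ∀ x' ∈ G.nbr x, H.gdist (f x) (f x') ≤ R) ∧
      (∀ y, ∀ y' ∈ H.nbr y, G.gdist (f' y) (f' y') ≤ R) ∧
      (∀ x, G.gdist x (f' (f x)) ≤ R) ∧ ∀ y, H.gdist y (f (f' y)) ≤ R := by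
  obtain ⟨hG, hH, Λ, C, hΛ, hC, hup, hlow, hsurj⟩ := h
  choose f' hf' using hsurj
  have hΛ0 : 0 ≤ Λ := by linarith
  obtain ⟨R, hR⟩ := exists_nat_ge (Λ * (2 * C + 1) + 2 * C)
  have hΛC : 0 ≤ Λ * C := mul_nonneg hΛ0 hC
  have tri : ∀ y y', (H.gdist (f (f' y)) (f (f' y')) : ℝ) ≤ H.gdist y y' + 2 * C :=
    fun y y' => by
      have h1 := hH.gdist_triangle (f (f' y)) y (f (f' y'))
      have h2 := hH.gdist_triangle y y' (f (f' y'))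
      have h3 := hf' y
      have h4 := hf' y'
      rw [hH.gdist_comm] at h4
      have h5 : (H.gdist (f (f' y)) (f (f' y')) : ℝ)
          ≤ H.gdist (f (f' y)) y + (H.gdist y y' + H.gdist y' (f (f' y'))) := by
        exact_mod_cast h1.trans (Nat.add_le_add_left h2 _)
      linarith
  obtain ⟨N, hN⟩ := hG.exists_fibreBound hDG (F := f) (R := R) fun x x' hx => by
    have h1 := hlow x x'
    rw [hx, gdist_self] at h1
    have h2 : (G.gdist x x' : ℝ) ≤ R := by push_cast at h1; nlinarith
    exact_mod_cast h2
  obtain ⟨N', hN'⟩ := hH.exists_fibreBound hDH (F := f') (R := R) fun y y' hy => by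
    have h1 := hH.gdist_triangle y (f (f' y)) y'
    have h2 := hf' y
    have h3 := hf' y'
    rw [hH.gdist_comm] at h2
    rw [← hy] at h3
    have h4 : (H.gdist y y' : ℝ) ≤ H.gdist y (f (f' y)) + H.gdist (f (f' y)) y' := by
      exact_mod_cast h1
    have h5 : (H.gdist y y' : ℝ) ≤ R := by nlinarith
    exact_mod_cast h5
  refine ⟨f', N, N', R, hN, hN', fun x x' hx => ?_, fun y y' hy => ?_, fun x => ?_, fun y => ?_⟩
  · have h1 := hup x x'
    have h2 : (G.gdist x x' : ℝ) ≤ 1 := by exact_mod_cast gdist_le_one hx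
    have h3 : (H.gdist (f x) (f x') : ℝ) ≤ R := by nlinarith
    exact_mod_cast h3
  · have h1 := hlow (f' y) (f' y')
    have h2 : (H.gdist y y' : ℝ) ≤ 1 := by exact_mod_cast gdist_le_one hy
    have h3 := tri y y'
    have h4 : Λ * (H.gdist (f (f' y)) (f (f' y')) : ℝ) ≤ Λ * (1 + 2 * C) := by
      gcongr
      linarith
    have h5 : (G.gdist (f' y) (f' y') : ℝ) ≤ R := by linarith
    exact_mod_cast h5
  · have h1 := hlow x (f' (f x))
    have h2 := hf' (f x)
    rw [hH.gdist_comm] at h2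
    have h3 : Λ * (H.gdist (f x) (f (f' (f x))) : ℝ) ≤ Λ * C := by gcongr
    have h4 : (G.gdist x (f' (f x)) : ℝ) ≤ R := by linarith
    exact_mod_cast h4
  · have h1 := hf' y
    rw [hH.gdist_comm] at h1
    have h2 : (H.gdist y (f (f' y)) : ℝ) ≤ R := by nlinarith
    exact_mod_cast h2

end LFGraph


/-- If `Γ` has `IS_d` and non-trivial reduced `ℓ^p`-cohomology in
degree one for some `1 ≤ p < d/2`, then every bounded-valency graph
quasi-isometric to `Γ` admits a non-constant bounded harmonic function. -/
theorem stmt6 {X Y : Type*} (G : LFGraph X) (H : LFGraph Y)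
    (DG : ℕ) (hDG : G.BddVal DG) (DH : ℕ) (hDH : H.BddVal DH)
    (d p : ℝ) (hIS : G.ISdim d) (hp1 : 1 ≤ p) (hp2 : p < d / 2)
    (e0 : X) (g : X → ℝ) (hg : G.MemDp p g) (hnt : ¬ G.InClos p e0 g)
    (f : X → Y) (hqi : LFGraph.QI G H f) :
    ∃ h : Y → ℝ, H.Harmonic h ∧ BoundedFun h ∧ ∃ y z, h y ≠ h z := by
  classical
  obtain ⟨hG, hH, -⟩ := id hqi
  obtain ⟨f', N, N', R, hN, hN', hRf, hRf', hRX, hRY⟩ := hqi.exists_inverse hDG hDH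
  have hp0 : 0 < p := by linarith
  have htrunc : ∃ n : ℕ, ∀ c : ℝ, ∃ ε > 0, ¬ {x | ε ≤ |clamp n (g x) - c|}.Finite := by
    by_contra! hcon
    exact hnt (hg.inClos hp0 e0 hcon)
  obtain ⟨n, hn⟩ := htrunc
  set b : X → ℝ := fun x => clamp n (g x) with hb
  have hbD : G.MemDp p b := hg.of_abs_sub_le hp0.le fun x y => abs_clamp_sub_le _ _ _
  have hb'D : H.MemDp p fun y => b (f' y) := by
    obtain ⟨K, hK⟩ := LFGraph.exists_energy_comp_le hDH hDG hG hN' hRf' hp1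
    rw [LFGraph.memDp_iff_energy_ne_top hp0.le] at hbD ⊢
    exact ne_top_of_le_ne_top (ENNReal.mul_ne_top ENNReal.coe_ne_top hbD) (hK b)
  have hISH : H.ISdim d := hIS.of_coarse (by linarith) hDG hDH hH hN hN' hRf hRY
  obtain ⟨q, u, hq, hu, hlap⟩ := hISH.exists_lap_eq hDH hp1 hp2 (hb'D.lpMem_lap hp1 hDH)
  refine ⟨fun y => b (f' y) - u y, LFGraph.harmonic_sub_of_lap_eq hlap, ?_, ?_⟩
  · obtain ⟨M, hM⟩ := hu.boundedFun hq
    exact ⟨n + M, fun y => (abs_sub _ _).trans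
      (add_le_add (abs_clamp_le_s6 (Nat.cast_nonneg n) _) (hM y))⟩
  · by_contra! hconst
    obtain ⟨ε, hε, hinf⟩ := hn (b (f' (f e0)) - u (f e0))
    refine hinf (((hbD.finite_le_abs_sub hp1 hG hDG hRX (half_pos hε)).union
      (hN.finite_preimage (hu.finite_le_abs hq (half_pos hε)))).subset fun x hx => ?_)
    by_contra hnot
    simp only [Set.mem_union, Set.mem_ofPred_eq, Set.mem_preimage, not_or, not_le] at hnot hx
    have h1 : b x - (b (f' (f e0)) - u (f e0)) = u (f x) - (b (f' (f x)) - b x) := by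
      linarith [hconst (f x) (f e0)]
    have h2 : ε ≤ |u (f x) - (b (f' (f x)) - b x)| := by rw [← h1]; exact hx
    linarith [abs_sub (u (f x)) (b (f' (f x)) - b x)]
end

section
/- Let Γ be a graph satisfying the strong isoperimetric profile IS_ω, and let 1 < p < ∞. Then the ℓ^p-cohomology of Γ in degree one is reduced: the subspace ℓ^p(X) + ℝ·1 is closed in D^p(Γ), i.e. the natural quotient map from ℓ^pH^1(Γ) = D^p(Γ)/(ℓ^p(X)+ℝ·1) onto the reduced ℓ^p-cohomology is injective. -/
open scoped BigOperators ENNReal NNReal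
open Filter Topology

namespace LFGraph

variable {X : Type*}

open Classical in
/-- One-sided co-area inequality: a linear isoperimetric inequality for finite sets gives an
`ℓ^1` Sobolev inequality for nonnegative finitely supported functions. -/
theorem sum_le_mul_sum_posPart (G : LFGraph X) {κ : ℝ}
    (hIS : ∀ A : Finset X, A.Nonempty → (A.card : ℝ) ≤ κ * (G.bdry A : ℝ))
    (A : Finset X) (f : X → ℝ) (hf : ∀ x, 0 ≤ f x) (hA : ∀ x, x ∉ A → f x = 0) :
    ∑ x ∈ A, f x ≤ κ * ∑ x ∈ A, ∑ y ∈ G.nbr x, max (f x - f y) 0 := by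
  induction A using Finset.strongInduction generalizing f with
  | H A ih =>
  rcases A.eq_empty_or_nonempty with rfl | hne
  · simp
  obtain ⟨a, haA, hmin⟩ := A.exists_min_image f hne
  set k : X → ℝ := fun x => if x ∈ A then f x - f a else 0 with hk
  have hka : k a = 0 := by simp [hk]
  have hk0 : ∀ x, 0 ≤ k x := by
    intro x
    by_cases hx : x ∈ A
    · simpa [hk, hx] using hmin x hx
    · simp [hk, hx]
  have hkA : ∀ x, x ∉ A.erase a → k x = 0 := by
    intro x hx
    by_cases hxa : x = a
    · rw [hxa, hka]
    · have : x ∉ A := fun h => hx (Finset.mem_erase.2 ⟨hxa, h⟩)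
      simp [hk, this]
  have key := ih (A.erase a) (Finset.erase_ssubset haA) k hk0 hkA
  rw [Finset.sum_erase A hka, Finset.sum_erase A
    (Finset.sum_eq_zero fun y _ => by rw [hka]; simpa using hk0 y)] at key
  have hsum : ∑ x ∈ A, f x = A.card * f a + ∑ x ∈ A, k x := by
    rw [← nsmul_eq_mul, ← Finset.sum_const, ← Finset.sum_add_distrib]
    exact Finset.sum_congr rfl fun x hx => by simp [hk, hx]
  have hgrad : ∑ x ∈ A, ∑ y ∈ G.nbr x, max (f x - f y) 0
      = (G.bdry A : ℝ) * f a + ∑ x ∈ A, ∑ y ∈ G.nbr x, max (k x - k y) 0 := by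
    rw [bdry, Nat.cast_sum, Finset.sum_mul, ← Finset.sum_add_distrib]
    refine Finset.sum_congr rfl fun x hx => ?_
    rw [← nsmul_eq_mul, ← Finset.sum_const, Finset.sum_filter, ← Finset.sum_add_distrib]
    refine Finset.sum_congr rfl fun y _ => ?_
    by_cases hy : y ∈ A
    · simp [hk, hx, hy]
    · have h1 := hmin x hx
      have h2 := hf x
      simp [hk, hx, hy, hA y hy, h1, h2]
  rw [hsum, hgrad, mul_add, ← mul_assoc]
  exact add_le_add (mul_le_mul_of_nonneg_right (hIS A hne) (hf a)) key

/-- The increment of `t ↦ t ^ p` is at most a small multiple of the larger value plus a multiple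
of the `p`-th power of the increment of the argument. -/
theorem exists_rpow_sub_rpow_le {p δ : ℝ} (hp : 0 < p) (hδ : 0 < δ) :
    ∃ K : ℝ, 0 < K ∧ ∀ a b : ℝ, 0 ≤ a → 0 ≤ b →
      max (a ^ p - b ^ p) 0 ≤ δ * a ^ p + K * |a - b| ^ p := by
  wlog hδ1 : δ < 1 generalizing δ
  · obtain ⟨K, hK, h⟩ := this (δ := 1 / 2) (by norm_num) (by norm_num)
    refine ⟨K, hK, fun a b ha hb => (h a b ha hb).trans ?_⟩
    have := Real.rpow_nonneg ha p
    nlinarith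
  set r : ℝ := (1 - δ) ^ (1 / p) with hr
  have hrp : r ^ p = 1 - δ := by
    rw [hr, ← Real.rpow_mul (by linarith), one_div_mul_cancel hp.ne', Real.rpow_one]
  have hr0 : 0 ≤ r := Real.rpow_nonneg (by linarith) _
  have hr1 : r < 1 := Real.rpow_lt_one (by linarith) (by linarith) (by positivity)
  have h1r : 0 < 1 - r := by linarith
  refine ⟨((1 - r) ^ p)⁻¹, by positivity, fun a b ha hb => ?_⟩
  have hap := Real.rpow_nonneg ha p
  have hbp := Real.rpow_nonneg hb p
  have hd : 0 ≤ ((1 - r) ^ p)⁻¹ * |a - b| ^ p := by positivity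
  refine max_le ?_ (by positivity)
  rcases le_or_gt (r * a) b with h | h
  · have := Real.rpow_le_rpow (by positivity) h hp.le
    rw [Real.mul_rpow hr0 ha, hrp] at this
    linarith
  · have h2 : (1 - r) * a ≤ |a - b| := by
      have := le_abs_self (a - b)
      linarith
    have h3 := Real.rpow_le_rpow (by positivity) h2 hp.le
    rw [Real.mul_rpow h1r.le ha] at h3
    have h4 : a ^ p ≤ ((1 - r) ^ p)⁻¹ * |a - b| ^ p := by
      rw [inv_mul_eq_div, le_div_iff₀ (by positivity)]
      linarith
    have : 0 ≤ δ * a ^ p := by positivity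
    linarith

/-- The `ℓ^p` Sobolev inequality for nonnegative finitely supported functions. -/
theorem exists_sum_rpow_le (G : LFGraph X) {D : ℕ} (hval : G.BddVal D) (hIS : G.ISomega)
    {p : ℝ} (hp : 0 < p) :
    ∃ C : ℝ, 0 < C ∧ ∀ (A : Finset X) (f : X → ℝ), (∀ x, 0 ≤ f x) → (∀ x, x ∉ A → f x = 0) →
      ∑ x ∈ A, f x ^ p ≤ C * ∑ x ∈ A, ∑ y ∈ G.nbr x, |f x - f y| ^ p := by
  obtain ⟨κ, hκ, hIS⟩ := hIS
  obtain ⟨K, hK, hle⟩ := exists_rpow_sub_rpow_le (δ := 1 / (2 * κ * (D + 1))) hp (by positivity)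
  refine ⟨2 * κ * K, by positivity, fun A f hf hA => ?_⟩
  have h1 := G.sum_le_mul_sum_posPart hIS A (fun x => f x ^ p)
    (fun x => Real.rpow_nonneg (hf x) p) (fun x hx => by simp [hA x hx, hp.ne'])
  have h2 : ∑ x ∈ A, ∑ y ∈ G.nbr x, max (f x ^ p - f y ^ p) 0
      ≤ 1 / (2 * κ) * ∑ x ∈ A, f x ^ p + K * ∑ x ∈ A, ∑ y ∈ G.nbr x, |f x - f y| ^ p := by
    rw [Finset.mul_sum, Finset.mul_sum, ← Finset.sum_add_distrib]
    refine Finset.sum_le_sum fun x _ => ?_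
    calc ∑ y ∈ G.nbr x, max (f x ^ p - f y ^ p) 0
        ≤ ∑ y ∈ G.nbr x, (1 / (2 * κ * (D + 1)) * f x ^ p + K * |f x - f y| ^ p) :=
          Finset.sum_le_sum fun y _ => hle _ _ (hf x) (hf y)
      _ = (G.nbr x).card * (1 / (2 * κ * (D + 1)) * f x ^ p)
          + K * ∑ y ∈ G.nbr x, |f x - f y| ^ p := by
          rw [Finset.sum_add_distrib, Finset.sum_const, nsmul_eq_mul, Finset.mul_sum]
      _ ≤ (D + 1) * (1 / (2 * κ * (D + 1)) * f x ^ p)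
          + K * ∑ y ∈ G.nbr x, |f x - f y| ^ p := by
          have hc : ((G.nbr x).card : ℝ) ≤ D + 1 := by
            exact_mod_cast (hval x).trans (Nat.le_succ D)
          have := Real.rpow_nonneg (hf x) p
          gcongr
      _ = _ := by field_simp
  have h3 := h1.trans (mul_le_mul_of_nonneg_left h2 hκ.le)
  have h4 : κ * (1 / (2 * κ) * ∑ x ∈ A, f x ^ p) = (∑ x ∈ A, f x ^ p) / 2 := by field_simp
  rw [mul_add, h4] at h3
  linarith

open Classical in
/-- Finite sums of a nonnegative function over oriented edges are bounded by its total sum. -/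
theorem sum_nbr_le_tsum (G : LFGraph X) {φ : X × X → ℝ} (hφ : ∀ e, 0 ≤ φ e)
    (hs : Summable fun e : G.Edge => φ e.1) (A : Finset X) :
    ∑ x ∈ A, ∑ y ∈ G.nbr x, φ (x, y) ≤ ∑' e : G.Edge, φ e.1 := by
  rw [← Finset.sum_finset_product
    ((A ×ˢ A.biUnion G.nbr).filter fun e => e.2 ∈ G.nbr e.1) A G.nbr
    (fun e => by simp only [Finset.mem_filter, Finset.mem_product, Finset.mem_biUnion]; tauto),
    ← Finset.sum_subtype_of_mem (p := fun e : X × X => e.2 ∈ G.nbr e.1) φ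
      (fun e he => (Finset.mem_filter.1 he).2)]
  exact hs.sum_le_tsum _ fun e _ => hφ e.1

/-- The `ℓ^p` Sobolev inequality for functions in `ℓ^p`. -/
theorem exists_sum_rpow_le_of_lpMem (G : LFGraph X) {D : ℕ} (hval : G.BddVal D)
    (hIS : G.ISomega) {p : ℝ} (hp : 0 < p) :
    ∃ C : ℝ, 0 < C ∧ ∀ f : X → ℝ, lpMem p f → G.MemDp p f → ∀ S : Finset X,
      ∑ x ∈ S, |f x| ^ p ≤ C * ∑' e : G.Edge, |G.grad f e| ^ p := by
  classical
  obtain ⟨C, hC, h⟩ := G.exists_sum_rpow_le hval hIS hp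
  refine ⟨C, hC, fun f hf hDf S => ?_⟩
  have htrunc : ∀ t : ℝ, 0 < t →
      ∑ x ∈ S, max (|f x| - t) 0 ^ p ≤ C * ∑' e : G.Edge, |G.grad f e| ^ p := by
    intro t ht
    have hfin : {x | t ≤ |f x|}.Finite := by
      have h0 := hf.tendsto_cofinite_zero.eventually_lt_const (Real.rpow_pos_of_pos ht p)
      refine (Filter.eventually_cofinite.1 h0).subset fun x hx => ?_
      exact not_lt.2 (Real.rpow_le_rpow ht.le hx hp.le)
    set A := S ∪ hfin.toFinset
    have h1 := h A (fun x => max (|f x| - t) 0) (fun x => le_max_right _ _) (fun x hx => by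
      have : ¬ t ≤ |f x| := fun h' => hx (Finset.mem_union_right _ (by simpa using h'))
      exact max_eq_right (by linarith))
    calc ∑ x ∈ S, max (|f x| - t) 0 ^ p
        ≤ ∑ x ∈ A, max (|f x| - t) 0 ^ p :=
          Finset.sum_le_sum_of_subset_of_nonneg Finset.subset_union_left
            fun x _ _ => by positivity
      _ ≤ _ := h1
      _ ≤ C * ∑ x ∈ A, ∑ y ∈ G.nbr x, |f y - f x| ^ p := by
          refine mul_le_mul_of_nonneg_left (Finset.sum_le_sum fun x _ => Finset.sum_le_sum fun y _ =>
            Real.rpow_le_rpow (abs_nonneg _) ?_ hp.le) hC.le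
          calc |max (|f x| - t) 0 - max (|f y| - t) 0|
              ≤ |(|f x| - t) - (|f y| - t)| := abs_max_sub_max_le_abs _ _ _
            _ = |(|f y| - |f x|)| := by rw [sub_sub_sub_cancel_right, abs_sub_comm]
            _ ≤ |f y - f x| := abs_abs_sub_abs_le_abs_sub _ _
      _ ≤ _ := by
          gcongr
          exact G.sum_nbr_le_tsum (φ := fun e => |f e.2 - f e.1| ^ p)
            (fun e => by positivity) hDf A
  have hcont : Continuous fun t : ℝ => ∑ x ∈ S, max (|f x| - t) 0 ^ p :=
    continuous_finsetSum _ fun x _ =>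
      ((continuous_const.sub continuous_id).max continuous_const).rpow_const
        fun _ => Or.inr hp.le
  have hlim := (hcont.tendsto 0).mono_left (nhdsWithin_le_nhds (s := Set.Ioi 0))
  have hle := le_of_tendsto hlim
    (Filter.eventually_of_mem self_mem_nhdsWithin fun t ht => htrunc t ht)
  simpa using hle

/-- Convergence to zero at one vertex, together with convergence of the gradients to zero along
every edge, propagates through a connected graph. -/
theorem tendsto_zero_of_grad (G : LFGraph X) (hconn : G.Conn) {u : ℕ → X → ℝ} (e0 : X)
    (h0 : Tendsto (fun n => u n e0) atTop (𝓝 0))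
    (hgrad : ∀ e : G.Edge, Tendsto (fun n => G.grad (u n) e) atTop (𝓝 0)) (x : X) :
    Tendsto (fun n => u n x) atTop (𝓝 0) := by
  induction hconn e0 x with
  | refl => exact h0
  | tail _ hyz ih => simpa [grad] using ih.add (hgrad ⟨(_, _), hyz⟩)

end LFGraph

theorem abs_add_rpow_le {p : ℝ} (hp : 0 < p) (a b : ℝ) :
    |a + b| ^ p ≤ 2 ^ p * (|a| ^ p + |b| ^ p) := by
  have hm : |a + b| ≤ 2 * max |a| |b| := by
    have := abs_add_le a b
    have := le_max_left |a| |b|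
    have := le_max_right |a| |b|
    linarith
  have h1 := Real.rpow_le_rpow (abs_nonneg _) hm hp.le
  rw [Real.mul_rpow (by norm_num) (by positivity)] at h1
  refine h1.trans (mul_le_mul_of_nonneg_left ?_ (by positivity))
  have ha : 0 ≤ |a| ^ p := by positivity
  have hb : 0 ≤ |b| ^ p := by positivity
  rcases max_choice |a| |b| with h | h <;> rw [h] <;> linarith


/-- If `Γ` has `IS_ω` and `1 < p < ∞`, then the `ℓ^p`-cohomology in
degree one is reduced: the subspace `ℓ^p(X) + ℝ·1` is closed in `D^p(Γ)`, i.e. any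
`g ∈ D^p(Γ)` in the `D^p`-closure of `ℓ^p(X) + ℝ·1` actually lies in it. -/
theorem stmt7 {X : Type*} (G : LFGraph X) (hconn : G.Conn) (D : ℕ) (hval : G.BddVal D)
    (hIS : G.ISomega) (p : ℝ) (hp1 : 1 < p) (e0 : X)
    (g : X → ℝ) (hg : G.MemDp p g) (hclos : G.InClos p e0 g) :
    ∃ (f : X → ℝ) (c : ℝ), lpMem p f ∧ ∀ x, g x = f x + c := by
  have hp : 0 < p := by linarith
  obtain ⟨C, hC, hsob⟩ := G.exists_sum_rpow_le_of_lpMem hval hIS hp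
  choose f c hf hmem hdist using fun n : ℕ => hclos (1 / ((n : ℝ) + 1)) (by positivity)
  set u : ℕ → X → ℝ := fun n x => g x - (f n x + c n) with hu
  have hT0 : ∀ n, 0 ≤ ∑' e : G.Edge, |G.grad (u n) e| ^ p :=
    fun n => tsum_nonneg fun e => by positivity
  have hroot : ∀ n, (∑' e : G.Edge, |G.grad (u n) e| ^ p) ^ (1 / p) + |u n e0|
      < 1 / ((n : ℝ) + 1) := hdist
  have hT : ∀ n, ∑' e : G.Edge, |G.grad (u n) e| ^ p ≤ (1 / ((n : ℝ) + 1)) ^ p := by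
    intro n
    have h1 : (∑' e : G.Edge, |G.grad (u n) e| ^ p) ^ (1 / p) ≤ 1 / ((n : ℝ) + 1) := by
      linarith [hroot n, abs_nonneg (u n e0)]
    have h2 := Real.rpow_le_rpow (Real.rpow_nonneg (hT0 n) _) h1 hp.le
    rwa [← Real.rpow_mul (hT0 n), one_div_mul_cancel hp.ne', Real.rpow_one] at h2
  have hu0 : ∀ n, |u n e0| ≤ 1 / ((n : ℝ) + 1) := fun n => by
    linarith [hroot n, Real.rpow_nonneg (hT0 n) (1 / p)]
  have hue : ∀ (e : G.Edge) n, |G.grad (u n) e| ≤ 1 / ((n : ℝ) + 1) := fun e n =>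
    (Real.rpow_le_rpow_iff (abs_nonneg _) (by positivity) hp).1
      (((hmem n).le_tsum e fun e _ => by positivity).trans (hT n))
  have hulim := G.tendsto_zero_of_grad hconn e0
    (squeeze_zero_norm hu0 tendsto_one_div_add_atTop_nhds_zero_nat)
    (fun e => squeeze_zero_norm (hue e) tendsto_one_div_add_atTop_nhds_zero_nat)
  have hone : ∀ n : ℕ, 1 / ((n : ℝ) + 1) ≤ 1 := fun n => by
    rw [div_le_one (by positivity)]
    linarith [n.cast_nonneg (α := ℝ)]
  set M : ℝ := C * (2 ^ p * ((∑' e : G.Edge, |G.grad g e| ^ p) + 1))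
  have hbound : ∀ n (S : Finset X), ∑ x ∈ S, |f n x| ^ p ≤ M := by
    intro n S
    have hpt : ∀ e, |G.grad (f n) e| ^ p
        ≤ 2 ^ p * (|G.grad g e| ^ p + |G.grad (u n) e| ^ p) := by
      intro e
      have h1 := abs_add_rpow_le hp (G.grad g e) (-G.grad (u n) e)
      have h2 : G.grad g e + -G.grad (u n) e = G.grad (f n) e := by
        simp only [LFGraph.grad, hu]
        ring
      rwa [h2, abs_neg] at h1
    have hsum : Summable fun e => 2 ^ p * (|G.grad g e| ^ p + |G.grad (u n) e| ^ p) :=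
      (Summable.add hg (hmem n)).mul_left _
    have hDf : G.MemDp p (f n) := Summable.of_nonneg_of_le (fun e => by positivity) hpt hsum
    refine (hsob (f n) (hf n) hDf S).trans (mul_le_mul_of_nonneg_left ?_ hC.le)
    refine (Summable.tsum_le_tsum hpt hDf hsum).trans ?_
    rw [tsum_mul_left, Summable.tsum_add hg (hmem n)]
    have h1 : ∑' e : G.Edge, |G.grad (u n) e| ^ p ≤ 1 :=
      (hT n).trans (Real.rpow_le_one (by positivity) (hone n) hp.le)
    gcongr
  have hc : ∀ n, c n ∈ Metric.closedBall (0 : ℝ) (|g e0| + 1 + M ^ (1 / p)) := by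
    intro n
    have h1 : |f n e0| ^ p ≤ M := by simpa using hbound n {e0}
    have h2 : |f n e0| ≤ M ^ (1 / p) := by
      have := Real.rpow_le_rpow (by positivity) h1 (one_div_pos.2 hp).le
      rwa [← Real.rpow_mul (abs_nonneg _), mul_one_div_cancel hp.ne', Real.rpow_one] at this
    have h3 : c n = g e0 - u n e0 - f n e0 := by
      simp only [hu]
      ring
    rw [mem_closedBall_zero_iff, Real.norm_eq_abs, h3]
    linarith [abs_sub (g e0 - u n e0) (f n e0), abs_sub (g e0) (u n e0), hu0 n, hone n]
  obtain ⟨c', -, φ, hφ, hcφ⟩ := tendsto_subseq_of_bounded Metric.isBounded_closedBall hc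
  have hflim : ∀ x, Tendsto (fun n => f (φ n) x) atTop (𝓝 (g x - c')) := by
    intro x
    have h1 := (tendsto_const_nhds (x := g x)).sub
      (((hulim x).comp hφ.tendsto_atTop).add hcφ)
    rw [zero_add] at h1
    refine h1.congr fun n => ?_
    simp only [hu, Function.comp_apply]
    ring
  refine ⟨fun x => g x - c', c', ?_, fun x => by ring⟩
  refine summable_of_sum_le (fun x => by positivity) (c := M) fun S => ?_
  exact le_of_tendsto
    (tendsto_finsetSum S fun x _ => (hflim x).abs.rpow_const (Or.inr hp.le))
    (Eventually.of_forall fun n => hbound (φ n) S)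
end
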